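/- Let α ∈ ℝ, s > 1/2, and let u ∈ C^∞(ℝ; H^s₊(S¹)) solve the α-Szegő equation i∂ₜu = Π(|u|²u) + α(u|1). Then the pair (K_u, C_u) with C_u := (i/2)K_u² − i T_{|u|²} is a Lax pair: d/dt K_{u(t)} = [C_{u(t)}, K_{u(t)}] for all t. Consequently, for every t the operator K_{u(t)} is unitarily equivalent to K_{u(0)}, and the spectrum of the positive self-adjoint operator K_{u(t)}² is independent of t. -/

import Mathlib

open Complex Filter
open scoped ComplexConjugate Topology ENNReal

noncomputable section

/-- ℓ²(ℕ, ℂ): the sequence model of the Hardy space L²₊(S¹), identifying a function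
with its sequence of nonnegative Fourier coefficients. -/
abbrev Hardy : Type := lp (fun _ : ℕ => ℂ) 2

/-- A coefficient sequence belongs to L²₊. -/
def MemL2 (u : ℕ → ℂ) : Prop := Memℓp u 2

/-- A coefficient sequence belongs to the Sobolev space H^s₊. -/
def MemHs (s : ℝ) (u : ℕ → ℂ) : Prop :=
  Summable fun n : ℕ => ((1 : ℝ) + (n : ℝ) ^ 2) ^ s * ‖u n‖ ^ 2

/-- The squared H^s norm of a coefficient sequence. -/
def hsNormSq (s : ℝ) (u : ℕ → ℂ) : ℝ :=
  ∑' n : ℕ, ((1 : ℝ) + (n : ℝ) ^ 2) ^ s * ‖u n‖ ^ 2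

/-- The L² inner product (f|g), ℂ-linear in the first argument. -/
def hinner (f g : ℕ → ℂ) : ℂ := ∑' n : ℕ, f n * conj (g n)

/-- The squared L² norm. -/
def l2normSq (f : ℕ → ℂ) : ℝ := ∑' n : ℕ, ‖f n‖ ^ 2

/-- Coefficients of the constant function 1. -/
def oneSeq : ℕ → ℂ := fun n => if n = 0 then 1 else 0

/-- The Hankel operator H_u(h) = Π(u ⬝ conj h) in Fourier coefficients. -/
def hankel (u h : ℕ → ℂ) : ℕ → ℂ := fun k => ∑' ℓ : ℕ, u (k + ℓ) * conj (h ℓ)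

/-- The shifted Hankel operator K_u = T_z^* ∘ H_u in Fourier coefficients. -/
def khankel (u h : ℕ → ℂ) : ℕ → ℂ := fun k => ∑' ℓ : ℕ, u (k + 1 + ℓ) * conj (h ℓ)

/-- H_u². -/
def hu2 (u h : ℕ → ℂ) : ℕ → ℂ := hankel u (hankel u h)

/-- K_u². -/
def ku2 (u h : ℕ → ℂ) : ℕ → ℂ := khankel u (khankel u h)

/-- The m-th Fourier coefficient of |u|², m ∈ ℤ. -/
def absSqCoeff (u : ℕ → ℂ) (m : ℤ) : ℂ :=
  ∑' q : ℕ × ℕ, if ((q.1 : ℤ) - (q.2 : ℤ) = m) then u q.1 * conj (u q.2) else 0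

/-- The Toeplitz operator T_{|u|²} in Fourier coefficients. -/
def toeplitzAbsSq (u h : ℕ → ℂ) : ℕ → ℂ :=
  fun k => ∑' ℓ : ℕ, absSqCoeff u ((k : ℤ) - (ℓ : ℤ)) * h ℓ

/-- Fourier coefficients of Π(|u|²u). -/
def cubic (u : ℕ → ℂ) : ℕ → ℂ := fun n =>
  ∑' q : ℕ × ℕ × ℕ, if q.1 + q.2.2 = q.2.1 + n then u q.1 * conj (u q.2.1) * u q.2.2 else 0

/-- `u : ℝ → (ℕ → ℂ)` solves the α-Szegő equation i ∂ₜ u = Π(|u|²u) + α(u|1),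
written coefficientwise on nonnegative Fourier modes. -/
def SolvesSzego (α : ℝ) (u : ℝ → ℕ → ℂ) : Prop :=
  ∀ n t, HasDerivAt (fun τ => u τ n)
    (-Complex.I * (cubic (u t) n + (α : ℂ) * u t 0 * oneSeq n)) t

/-- `u` is a smooth curve valued in H^s₊. -/
def SmoothHsCurve (s : ℝ) (u : ℝ → ℕ → ℂ) : Prop :=
  (∀ t, MemHs s (u t)) ∧ ∀ n, ContDiff ℝ (⊤ : ℕ∞) fun t => u t n

/-- `u` is a continuous curve valued in H^s₊. -/
def ContHsCurve (s : ℝ) (u : ℝ → ℕ → ℂ) : Prop :=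
  (∀ t, MemHs s (u t)) ∧
    ∀ t₀ : ℝ, Tendsto (fun t => hsNormSq s (fun n => u t n - u t₀ n)) (𝓝 t₀) (𝓝 0)

/-- E_u(τ) = ker(H_u² − τ² I) as a subset of ℓ². -/
def Espace (u : ℕ → ℂ) (τ : ℝ) : Set (ℕ → ℂ) :=
  {h | MemL2 h ∧ hu2 u h = ((τ : ℂ) ^ 2) • h}

/-- F_u(τ) = ker(K_u² − τ² I) as a subset of ℓ². -/
def Fspace (u : ℕ → ℂ) (τ : ℝ) : Set (ℕ → ℂ) :=
  {h | MemL2 h ∧ ku2 u h = ((τ : ℂ) ^ 2) • h}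

/-- Σ_H(u): τ > 0 such that E_u(τ) is not orthogonal to u. -/
def SigmaH (u : ℕ → ℂ) : Set ℝ :=
  {τ : ℝ | 0 < τ ∧ ∃ v ∈ Espace u τ, hinner u v ≠ 0}

/-- Σ_K(u): τ ≥ 0 such that F_u(τ) is not orthogonal to u. -/
def SigmaK (u : ℕ → ℂ) : Set ℝ :=
  {τ : ℝ | 0 ≤ τ ∧ ∃ v ∈ Fspace u τ, hinner u v ≠ 0}

/-- `p` is the orthogonal projection of `w` on the subspace `V` of ℓ². -/
def IsOrthProj (V : Set (ℕ → ℂ)) (w p : ℕ → ℂ) : Prop :=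
  p ∈ V ∧ ∀ v ∈ V, hinner (w - p) v = 0

/-- The rank of the shifted Hankel operator K_u. -/
def kuRank (u : ℕ → ℂ) : Cardinal :=
  Module.rank ℂ (Submodule.span ℂ (khankel u '' {h | MemL2 h}))

/-- The rank of the Hankel operator H_u. -/
def huRank (u : ℕ → ℂ) : Cardinal :=
  Module.rank ℂ (Submodule.span ℂ (hankel u '' {h | MemL2 h}))

/-- ℒ(N) : rank K_u = N. -/
def InLN (N : ℕ) (u : ℕ → ℂ) : Prop := MemL2 u ∧ kuRank u = N

/-- The constant function 1 as an element of ℓ². -/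
def oneH : Hardy := lp.single 2 0 1


/-- The operator C_u = (i/2) K_u² − i T_{|u|²}. -/
def Cop (u h : ℕ → ℂ) : ℕ → ℂ := fun k =>
  Complex.I / 2 * ku2 u h k - Complex.I * toeplitzAbsSq u h k

/-- The Banach space of absolutely summable coefficient sequences. -/
abbrev Wiener : Type := lp (fun _ : ℕ => ℂ) 1

/-- A bounded family indexed by `ℕ`, summed against a summable coefficient sequence. -/
def superpose {E : Type*} [NormedAddCommGroup E] [NormedSpace ℂ E] [CompleteSpace E]
    (B : ℕ → E) (hB : ∀ m, ‖B m‖ ≤ 1) : Wiener →L[ℂ] E :=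
  have hs : ∀ c : Wiener, Summable fun m => ‖c m • B m‖ := fun c => by
    have h := (lp.memℓp c).summable (by norm_num)
    refine Summable.of_nonneg_of_le (fun _ => norm_nonneg _) (fun m => ?_) h
    rw [norm_smul]
    simpa using mul_le_mul_of_nonneg_left (hB m) (norm_nonneg (c m))
  LinearMap.mkContinuous
    { toFun := fun c => ∑' m, c m • B m
      map_add' := fun c d => by
        rw [← (hs c).of_norm.tsum_add (hs d).of_norm]
        exact tsum_congr fun m => by simp [add_smul]
      map_smul' := fun a c => by
        rw [RingHom.id_apply, ← (hs c).of_norm.tsum_const_smul]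
        exact tsum_congr fun m => by simp [mul_smul] } 1 fun c => by
    have h := lp.hasSum_norm (p := 1) (by norm_num) c
    simp only [ENNReal.toReal_one, Real.rpow_one] at h
    rw [one_mul]
    refine tsum_of_norm_bounded h fun m => ?_
    rw [norm_smul]
    simpa using mul_le_mul_of_nonneg_left (hB m) (norm_nonneg (c m))

theorem superpose_hasSum {E : Type*} [NormedAddCommGroup E] [NormedSpace ℂ E] [CompleteSpace E]
    (B : ℕ → E) (hB : ∀ m, ‖B m‖ ≤ 1) (c : Wiener) :
    HasSum (fun m => c m • B m) (superpose B hB c) := by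
  have h := (lp.memℓp c).summable (by norm_num)
  refine Summable.hasSum (Summable.of_norm ?_)
  refine Summable.of_nonneg_of_le (fun _ => norm_nonneg _) (fun m => ?_) h
  rw [norm_smul]
  simpa using mul_le_mul_of_nonneg_left (hB m) (norm_nonneg (c m))

theorem norm_superpose_le {E : Type*} [NormedAddCommGroup E] [NormedSpace ℂ E] [CompleteSpace E]
    (B : ℕ → E) (hB : ∀ m, ‖B m‖ ≤ 1) (c : Wiener) : ‖superpose B hB c‖ ≤ ‖c‖ := by
  have h := lp.hasSum_norm (p := 1) (by norm_num) c
  simp only [ENNReal.toReal_one, Real.rpow_one] at h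
  rw [← (superpose_hasSum B hB c).tsum_eq]
  refine tsum_of_norm_bounded h fun m => ?_
  rw [norm_smul]
  simpa using mul_le_mul_of_nonneg_left (hB m) (norm_nonneg (c m))

theorem memℓp_two_iff {f : ℕ → ℂ} : Memℓp f 2 ↔ Summable fun n => ‖f n‖ ^ 2 := by
  rw [memℓp_gen_iff (by norm_num)]
  simp

theorem Hardy.norm_sq_eq (f : Hardy) : ‖f‖ ^ 2 = ∑' n, ‖f n‖ ^ 2 := by
  have := lp.norm_rpow_eq_tsum (p := 2) (by norm_num) f
  simpa using this

theorem Hardy.summable_norm_sq (f : Hardy) : Summable fun n => ‖f n‖ ^ 2 :=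
  memℓp_two_iff.1 (lp.memℓp f)

theorem Wiener.norm_eq (f : Wiener) : ‖f‖ = ∑' n, ‖f n‖ := by
  have := lp.norm_rpow_eq_tsum (p := 1) (by norm_num) f
  simpa using this

theorem Wiener.summable_norm (f : Wiener) : Summable fun n => ‖f n‖ := by
  simpa using (lp.memℓp f).summable (by norm_num)

theorem summable_partialReindex {p : ℕ → Prop} [DecidablePred p] {σ : ℕ → ℕ}
    (hσ : Set.InjOn σ {k | p k}) (h : Hardy) :
    (Summable fun k => ‖if p k then h (σ k) else 0‖ ^ 2) ∧
      ∑' k, ‖if p k then h (σ k) else 0‖ ^ 2 ≤ ‖h‖ ^ 2 := by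
  have hinj : Function.Injective fun k : {k | p k} => σ k := fun a b hab =>
    Subtype.ext (hσ a.2 b.2 hab)
  have hs := h.summable_norm_sq
  have heq : (fun k => ‖if p k then h (σ k) else 0‖ ^ 2)
      = Set.indicator {k | p k} fun k => ‖h (σ k)‖ ^ 2 := by
    ext k
    by_cases hk : p k <;> simp [Set.indicator, hk]
  rw [heq]
  constructor
  · rw [← summable_subtype_iff_indicator]
    exact hs.comp_injective hinj
  · rw [← tsum_subtype, h.norm_sq_eq]
    exact tsum_comp_le_tsum_of_inj hs (fun _ => by positivity) hinj

/-- The contraction of the Hardy space induced by a partial injection of the indices. -/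
def partialReindex (p : ℕ → Prop) [DecidablePred p] (σ : ℕ → ℕ)
    (hσ : Set.InjOn σ {k | p k}) : Hardy →L[ℂ] Hardy :=
  LinearMap.mkContinuous
    { toFun := fun h => ⟨fun k => if p k then h (σ k) else 0,
        memℓp_two_iff.2 (summable_partialReindex hσ h).1⟩
      map_add' := fun f g => by
        ext k
        change (if p k then (f + g) (σ k) else 0)
          = (if p k then f (σ k) else 0) + if p k then g (σ k) else 0
        by_cases hk : p k <;> simp [hk]
      map_smul' := fun c f => by
        ext k
        by_cases hk : p k <;> simp [hk] } 1 fun h => by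
    rw [one_mul]
    refine le_of_sq_le_sq ?_ (norm_nonneg _)
    rw [Hardy.norm_sq_eq]
    exact (summable_partialReindex hσ h).2

theorem partialReindex_apply (p : ℕ → Prop) [DecidablePred p] (σ : ℕ → ℕ)
    (hσ : Set.InjOn σ {k | p k}) (h : Hardy) (k : ℕ) :
    partialReindex p σ hσ h k = if p k then h (σ k) else 0 := rfl

theorem norm_partialReindex_le (p : ℕ → Prop) [DecidablePred p] (σ : ℕ → ℕ)
    (hσ : Set.InjOn σ {k | p k}) : ‖partialReindex p σ hσ‖ ≤ 1 :=
  LinearMap.mkContinuous_norm_le _ zero_le_one _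

theorem injOn_sub_right (m : ℕ) : Set.InjOn (fun k => m - (k + 1)) {k | k + 1 ≤ m} :=
  fun a ha b hb hab => by
    simp only [Set.mem_ofPred_eq] at *
    omega

theorem injOn_sub_left (m : ℕ) : Set.InjOn (fun k => k - m) {k | m ≤ k} :=
  fun a ha b hb hab => by
    simp only [Set.mem_ofPred_eq] at *
    omega

/-- The linear Hankel matrix operator `h ↦ (∑ ℓ, u (k + 1 + ℓ) * h ℓ)_k`, so that
`K_u h = hankelMatrix u (star h)`. -/
def hankelMatrix : Wiener →L[ℂ] (Hardy →L[ℂ] Hardy) :=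
  superpose (fun m => partialReindex (fun k => k + 1 ≤ m) (fun k => m - (k + 1))
    (injOn_sub_right m))
    fun _ => norm_partialReindex_le _ _ _

/-- Multiplication by the function with coefficients `u`. -/
def mulOp : Wiener →L[ℂ] (Hardy →L[ℂ] Hardy) :=
  superpose (fun m => partialReindex (fun k => m ≤ k) (fun k => k - m)
    (injOn_sub_left m))
    fun _ => norm_partialReindex_le _ _ _

theorem norm_mulOp_le (u : Wiener) : ‖mulOp u‖ ≤ ‖u‖ := norm_superpose_le _ _ u

theorem superpose_apply_hasSum (B : ℕ → Hardy →L[ℂ] Hardy) (hB : ∀ m, ‖B m‖ ≤ 1) (c : Wiener)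
    (h : Hardy) (k : ℕ) : HasSum (fun m => c m * B m h k) (superpose B hB c h k) := by
  have := ((lp.evalCLM ℂ (fun _ : ℕ => ℂ) 2 k).comp
    (ContinuousLinearMap.apply ℂ Hardy h)).hasSum (superpose_hasSum B hB c)
  exact this

theorem hankelMatrix_hasSum (u : Wiener) (h : Hardy) (k : ℕ) :
    HasSum (fun ℓ => u (k + 1 + ℓ) * h ℓ) (hankelMatrix u h k) := by
  have h1 : HasSum (fun m => u m * if k + 1 ≤ m then h (m - (k + 1)) else 0)
      (hankelMatrix u h k) :=
    superpose_apply_hasSum (fun m => partialReindex (fun k => k + 1 ≤ m)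
      (fun k => m - (k + 1)) (injOn_sub_right m)) (fun _ => norm_partialReindex_le _ _ _) u h k
  rw [← (add_right_injective (k + 1)).hasSum_iff] at h1
  · convert h1 using 2 with ℓ
    simp only [Function.comp_apply]
    rw [if_pos (Nat.le_add_right _ _), Nat.add_sub_cancel_left]
  · intro m hm
    have hm' : ¬k + 1 ≤ m := fun hle => hm ⟨m - (k + 1), by simp only; omega⟩
    rw [if_neg hm', mul_zero]

theorem mulOp_hasSum (u : Wiener) (h : Hardy) (n : ℕ) :
    HasSum (fun a => u a * if a ≤ n then h (n - a) else 0) (mulOp u h n) :=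
  superpose_apply_hasSum (fun m => partialReindex (fun k => m ≤ k) (fun k => k - m)
    (injOn_sub_left m))
    (fun _ => norm_partialReindex_le _ _ _) u h n

/-- The Toeplitz operator `T_{|u|²}` on the Hardy space. -/
def toeplitzOp (u : Wiener) : Hardy →L[ℂ] Hardy :=
  (ContinuousLinearMap.adjoint (mulOp u)).comp (mulOp u)

/-- An absolutely summable sequence, seen as an element of the Hardy space. -/
def Wiener.toHardy (u : Wiener) : Hardy :=
  ⟨u, (lp.memℓp u).of_exponent_ge (by norm_num)⟩

theorem hasSum_of_eq {β : Type*} {f g : β → ℂ} {a : ℂ} (hf : HasSum f a) (h : ∀ b, g b = f b) :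
    HasSum g a :=
  (funext h : g = f) ▸ hf

theorem hasSum_of_iterated {β γ : Type*} {f : β × γ → ℂ} {g : β → ℂ} {a : ℂ} (hs : Summable f)
    (h1 : ∀ b, HasSum (fun c => f (b, c)) (g b)) (h2 : HasSum g a) : HasSum f a := by
  have h3 := hs.hasSum.prod_fiberwise h1
  rw [h2.unique h3]
  exact hs.hasSum

theorem mulOp_single (u : Wiener) (k n : ℕ) :
    mulOp u (lp.single 2 k 1) n = if k ≤ n then u (n - k) else 0 := by
  refine (mulOp_hasSum u _ n).unique ?_
  by_cases hk : k ≤ n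
  · rw [if_pos hk]
    convert hasSum_single (n - k) ?_ using 1
    · rw [if_pos (Nat.sub_le _ _), Nat.sub_sub_self hk]
      simp
    · intro a ha
      split_ifs with h
      · rw [lp.single_apply_ne, mul_zero]
        omega
      · rw [mul_zero]
  · rw [if_neg hk]
    convert hasSum_zero using 2 with a
    split_ifs with h
    · rw [lp.single_apply_ne, mul_zero]
      omega
    · rw [mul_zero]

theorem adjoint_mulOp_hasSum (u : Wiener) (g : Hardy) (k : ℕ) :
    HasSum (fun b => conj (u b) * g (k + b)) (ContinuousLinearMap.adjoint (mulOp u) g k) := by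
  have h1 : inner ℂ (lp.single 2 k (1 : ℂ) : Hardy) (ContinuousLinearMap.adjoint (mulOp u) g)
      = ContinuousLinearMap.adjoint (mulOp u) g k := by
    refine (lp.inner_single_left (𝕜 := ℂ) (G := fun _ => ℂ) k (1 : ℂ) _).trans ?_
    simp
  rw [← h1, ContinuousLinearMap.adjoint_inner_right]
  have h2 := lp.hasSum_inner (𝕜 := ℂ) (G := fun _ : ℕ => ℂ) (mulOp u (lp.single 2 k (1 : ℂ))) g
  rw [← (add_right_injective k).hasSum_iff] at h2
  · refine hasSum_of_eq h2 fun b => ?_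
    simp only [Function.comp_apply]
    rw [mulOp_single, if_pos (Nat.le_add_right _ _), Nat.add_sub_cancel_left]
    exact mul_comm _ _
  · intro n hn
    have hn' : ¬k ≤ n := fun hle => hn ⟨n - k, by simp only; omega⟩
    rw [mulOp_single, if_neg hn']
    simp

theorem toeplitzOp_hasSum (u : Wiener) (x : Hardy) (n : ℕ) :
    HasSum (fun q : ℕ × ℕ × ℕ =>
      if q.1 + q.2.2 = q.2.1 + n then x q.1 * (conj (u q.2.1) * u q.2.2) else 0)
      (toeplitzOp u x n) := by
  have hs : Summable fun p : ℕ × ℕ =>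
      conj (u p.1) * (u p.2 * if p.2 ≤ n + p.1 then x (n + p.1 - p.2) else 0) := by
    have h1 := (u.summable_norm.mul_of_nonneg u.summable_norm (fun _ => norm_nonneg _)
      (fun _ => norm_nonneg _)).mul_right ‖x‖
    refine Summable.of_norm_bounded h1 fun p => ?_
    rw [norm_mul, norm_mul, RCLike.norm_conj, mul_assoc]
    gcongr
    split_ifs
    · exact lp.norm_apply_le_norm (by norm_num) x _
    · simp
  have h2 := hasSum_of_iterated hs
    (fun b => (mulOp_hasSum u x (n + b)).mul_left (conj (u b)))
    (adjoint_mulOp_hasSum u (mulOp u x) n)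
  have hinj : Function.Injective fun p : ℕ × ℕ => (n + p.1 - p.2, p.1, p.2) := fun p q h => by
    simp only [Prod.mk.injEq] at h
    exact Prod.ext h.2.1 h.2.2
  rw [← hinj.hasSum_iff]
  · refine hasSum_of_eq h2 fun p => ?_
    simp only [Function.comp_apply]
    by_cases hp : p.2 ≤ n + p.1
    · rw [if_pos hp, if_pos (by omega)]
      ring
    · rw [if_neg hp, if_neg (by omega)]
      simp
  · rintro ⟨a, b, c⟩ hq
    rw [if_neg]
    intro h
    exact hq ⟨(b, c), by simp only [Prod.mk.injEq, and_true] at *; omega⟩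

theorem cubic_eq_toeplitzOp (u : Wiener) (n : ℕ) : cubic u n = toeplitzOp u u.toHardy n := by
  rw [← (toeplitzOp_hasSum u u.toHardy n).tsum_eq]
  refine tsum_congr fun q => ?_
  change _ = if _ then u q.1 * _ else _
  rw [mul_assoc]

theorem toeplitzAbsSq_eq_toeplitzOp (u : Wiener) (h : Hardy) (k : ℕ) :
    toeplitzAbsSq u h k = toeplitzOp u h k := by
  have hu := (u.summable_norm.mul_of_nonneg u.summable_norm (fun _ => norm_nonneg _)
      (fun _ => norm_nonneg _))
  have h1 := toeplitzOp_hasSum u h k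
  let e : ℕ × ℕ × ℕ ≃ ℕ × ℕ × ℕ := (Equiv.refl ℕ).prodCongr (Equiv.prodComm ℕ ℕ)
  rw [← e.hasSum_iff] at h1
  refine (h1.prod_fiberwise fun ℓ => ?_).tsum_eq
  have h2 : Summable fun q : ℕ × ℕ =>
      if (q.1 : ℤ) - (q.2 : ℤ) = (k : ℤ) - ℓ then u q.1 * conj (u q.2) else 0 := by
    refine Summable.of_norm_bounded hu fun q => ?_
    split_ifs
    · simp
    · simp only [norm_zero]
      positivity
  refine hasSum_of_eq (h2.hasSum.mul_right (h ℓ)) fun q => ?_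
  change (if ℓ + q.1 = q.2 + k then h ℓ * (conj (u q.2) * u q.1) else 0) = _
  by_cases hq : ℓ + q.1 = q.2 + k
  · rw [if_pos hq, if_pos (by omega)]
    ring
  · rw [if_neg hq, if_neg (by omega), zero_mul]

theorem khankel_eq_hankelMatrix (u : Wiener) (h : Hardy) :
    khankel u h = hankelMatrix u (star h) := by
  ext k
  exact (hankelMatrix_hasSum u (star h) k).tsum_eq

theorem khankel_hasSum (u : Wiener) (h : Hardy) (k : ℕ) :
    HasSum (fun ℓ => u (k + 1 + ℓ) * conj (h ℓ)) (hankelMatrix u (star h) k) :=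
  hankelMatrix_hasSum u (star h) k

/-- The quadruple family whose sum is `K_{Π(|u|²u)} h` at mode `k`, indexed by `(ℓ, a, b, c)`. -/
def quadTerm (u : Wiener) (h : Hardy) (k : ℕ) (q : ℕ × ℕ × ℕ × ℕ) : ℂ :=
  if q.2.1 + q.2.2.2 = q.2.2.1 + (k + 1 + q.1) then
    u q.2.1 * (conj (u q.2.2.1) * u q.2.2.2) * conj (h q.1) else 0

theorem summable_quadTerm (u : Wiener) (h : Hardy) (k : ℕ) : Summable (quadTerm u h k) := by
  have hinj : Function.Injective
      fun q : ℕ × ℕ × ℕ => (q.1 + q.2.2 - q.2.1 - (k + 1), q) := fun p q hpq => congrArg Prod.snd hpq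
  rw [← hinj.summable_iff]
  · have h1 := ((u.summable_norm.mul_of_nonneg (u.summable_norm.mul_of_nonneg u.summable_norm
      (fun _ => norm_nonneg _) (fun _ => norm_nonneg _)) (fun _ => norm_nonneg _)
      (fun _ => by positivity))).mul_right ‖h‖
    refine Summable.of_norm_bounded h1 fun q => ?_
    simp only [Function.comp_apply, quadTerm]
    split_ifs
    · rw [norm_mul, norm_mul, norm_mul, RCLike.norm_conj, RCLike.norm_conj]
      gcongr
      exact lp.norm_apply_le_norm (by norm_num) h _
    · simp only [norm_zero]
      positivity
  · rintro ⟨ℓ, a, b, c⟩ hq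
    rw [quadTerm, if_neg]
    intro hc
    exact hq ⟨(a, b, c), by simp only [Prod.mk.injEq, and_true] at *; omega⟩

theorem hankelMatrix_cubic_hasSum (u : Wiener) (h : Hardy) (k : ℕ) :
    HasSum (fun ℓ => cubic u (k + 1 + ℓ) * conj (h ℓ)) (∑' q, quadTerm u h k q) := by
  refine (summable_quadTerm u h k).hasSum.prod_fiberwise fun ℓ => ?_
  rw [cubic_eq_toeplitzOp]
  refine hasSum_of_eq ((toeplitzOp_hasSum u u.toHardy (k + 1 + ℓ)).mul_right (conj (h ℓ)))
    fun q => ?_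
  rw [ite_mul, zero_mul]
  rfl

theorem toeplitzOp_hankelMatrix_eq (u : Wiener) (h : Hardy) (k : ℕ) :
    toeplitzOp u (hankelMatrix u (star h)) k
      = ∑' q, {q : ℕ × ℕ × ℕ × ℕ | q.1 + 1 ≤ q.2.1}.indicator (quadTerm u h k) q := by
  let φ : (ℕ × ℕ × ℕ) × ℕ → ℕ × ℕ × ℕ × ℕ := fun r => (r.2, r.1.1 + 1 + r.2, r.1.2)
  have hφ : Function.Injective φ := by
    rintro ⟨⟨p, b, c⟩, ℓ⟩ ⟨⟨p', b', c'⟩, ℓ'⟩ hpq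
    simp only [φ, Prod.mk.injEq] at hpq ⊢
    omega
  have hs : HasSum ({q : ℕ × ℕ × ℕ × ℕ | q.1 + 1 ≤ q.2.1}.indicator (quadTerm u h k))
      (∑' q, {q : ℕ × ℕ × ℕ × ℕ | q.1 + 1 ≤ q.2.1}.indicator (quadTerm u h k) q) :=
    ((summable_quadTerm u h k).indicator _).hasSum
  rw [← hφ.hasSum_iff] at hs
  · refine (toeplitzOp_hasSum u _ k).unique (hs.prod_fiberwise fun q => ?_)
    have h1 := (khankel_hasSum u h q.1).mul_right
      (if q.1 + q.2.2 = q.2.1 + k then conj (u q.2.1) * u q.2.2 else 0)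
    rw [mul_ite, mul_zero] at h1
    refine hasSum_of_eq h1 fun ℓ => ?_
    change Set.indicator _ _ (ℓ, q.1 + 1 + ℓ, q.2) = _
    rw [Set.indicator_of_mem (by simp only [Set.mem_ofPred_eq]; omega), quadTerm]
    by_cases hq : q.1 + q.2.2 = q.2.1 + k
    · rw [if_pos hq, if_pos (by simp only; omega)]
      ring
    · rw [if_neg hq, if_neg (by simp only; omega), mul_zero]
  · rintro ⟨ℓ, a, b, c⟩ hq
    rw [Set.indicator_of_notMem]
    intro hc
    simp only [Set.mem_ofPred_eq] at hc
    exact hq ⟨((a - 1 - ℓ, b, c), ℓ), by simp only [φ, Prod.mk.injEq, and_true, true_and]; omega⟩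

theorem hankelMatrix_star_toeplitzOp_eq (u : Wiener) (h : Hardy) (k : ℕ) :
    hankelMatrix u (star (toeplitzOp u h)) k
      = ∑' q, {q : ℕ × ℕ × ℕ × ℕ | k + 1 ≤ q.2.2.2}.indicator (quadTerm u h k) q := by
  let φ : ℕ × ℕ × ℕ × ℕ → ℕ × ℕ × ℕ × ℕ := fun r => (r.2.1, r.2.2.1, r.2.2.2, k + 1 + r.1)
  have hφ : Function.Injective φ := by
    rintro ⟨m, ℓ, a, b⟩ ⟨m', ℓ', a', b'⟩ hpq
    simp only [φ, Prod.mk.injEq] at hpq ⊢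
    omega
  have hs : HasSum ({q : ℕ × ℕ × ℕ × ℕ | k + 1 ≤ q.2.2.2}.indicator (quadTerm u h k))
      (∑' q, {q : ℕ × ℕ × ℕ × ℕ | k + 1 ≤ q.2.2.2}.indicator (quadTerm u h k) q) :=
    ((summable_quadTerm u h k).indicator _).hasSum
  rw [← hφ.hasSum_iff] at hs
  · refine (khankel_hasSum u _ k).unique (hs.prod_fiberwise fun m => ?_)
    refine hasSum_of_eq ((toeplitzOp_hasSum u h m).star.mul_left (u (k + 1 + m))) fun q => ?_
    change Set.indicator _ _ (q.1, q.2.1, q.2.2, k + 1 + m) = u (k + 1 + m) *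
      star (if q.1 + q.2.2 = q.2.1 + m then h q.1 * (conj (u q.2.1) * u q.2.2) else 0)
    rw [Set.indicator_of_mem (by simp only [Set.mem_ofPred_eq]; omega), quadTerm]
    by_cases hq : q.1 + q.2.2 = q.2.1 + m
    · rw [if_pos hq, if_pos (by simp only; omega)]
      simp only [star_mul, RCLike.star_def, RCLike.conj_conj]
      ring
    · rw [if_neg hq, if_neg (by simp only; omega), star_zero, mul_zero]
  · rintro ⟨ℓ, a, b, c⟩ hq
    rw [Set.indicator_of_notMem]
    intro hc
    simp only [Set.mem_ofPred_eq] at hc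
    exact hq ⟨(c - (k + 1), ℓ, a, b), by simp only [φ, Prod.mk.injEq, true_and]; omega⟩

theorem hankelMatrix_cube_eq (u : Wiener) (h : Hardy) (k : ℕ) :
    hankelMatrix u (star (hankelMatrix u (star (hankelMatrix u (star h))))) k
      = ∑' q, {q : ℕ × ℕ × ℕ × ℕ | q.1 + 1 ≤ q.2.1 ∧ k + 1 ≤ q.2.2.2}.indicator
          (quadTerm u h k) q := by
  let φ : ℕ × ℕ × ℕ → ℕ × ℕ × ℕ × ℕ := fun r =>
    (r.2.2, r.2.1 + 1 + r.2.2, r.1 + 1 + r.2.1, k + 1 + r.1)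
  have hφ : Function.Injective φ := by
    rintro ⟨m, p, ℓ⟩ ⟨m', p', ℓ'⟩ hpq
    simp only [φ, Prod.mk.injEq] at hpq ⊢
    omega
  have hs : HasSum ({q : ℕ × ℕ × ℕ × ℕ | q.1 + 1 ≤ q.2.1 ∧ k + 1 ≤ q.2.2.2}.indicator
        (quadTerm u h k))
      (∑' q, {q : ℕ × ℕ × ℕ × ℕ | q.1 + 1 ≤ q.2.1 ∧ k + 1 ≤ q.2.2.2}.indicator
        (quadTerm u h k) q) :=
    ((summable_quadTerm u h k).indicator _).hasSum
  rw [← hφ.hasSum_iff] at hs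
  · refine (khankel_hasSum u _ k).unique (hs.prod_fiberwise fun m => ?_)
    refine hasSum_of_iterated (hs.summable.prod_factor m) (fun p => ?_)
      ((khankel_hasSum u (hankelMatrix u (star h)) m).star.mul_left (u (k + 1 + m)))
    have h1 := ((khankel_hasSum u h p).mul_left (conj (u (m + 1 + p)))).mul_left (u (k + 1 + m))
    have e : u (k + 1 + m) * star (u (m + 1 + p) * conj (hankelMatrix u (star h) p))
        = u (k + 1 + m) * (conj (u (m + 1 + p)) * hankelMatrix u (star h) p) := by
      simp only [star_mul, RCLike.star_def, RCLike.conj_conj]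
      ring
    refine e ▸ hasSum_of_eq h1 fun ℓ => ?_
    change Set.indicator _ _ (ℓ, p + 1 + ℓ, m + 1 + p, k + 1 + m) = _
    rw [Set.indicator_of_mem (by simp only [Set.mem_ofPred_eq]; omega), quadTerm,
      if_pos (by simp only; omega)]
    ring
  · rintro ⟨ℓ, a, b, c⟩ hq
    by_cases hc : ℓ + 1 ≤ a ∧ k + 1 ≤ c
    · rw [Set.indicator_of_mem (by simpa using hc), quadTerm, if_neg]
      intro (hd : a + c = b + (k + 1 + ℓ))
      exact hq ⟨(c - (k + 1), a - 1 - ℓ, ℓ), by simp only [φ, Prod.mk.injEq, true_and]; omega⟩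
    · rw [Set.indicator_of_notMem (by simpa using hc)]

/-- The commutator identity `K_{Π(|u|²u)} = T_{|u|²} K_u + K_u T_{|u|²} - K_u³`. -/
theorem hankelMatrix_cubic_identity (u : Wiener) (h : Hardy) (k : ℕ) :
    HasSum (fun ℓ => cubic u (k + 1 + ℓ) * conj (h ℓ))
      (toeplitzOp u (hankelMatrix u (star h)) k + hankelMatrix u (star (toeplitzOp u h)) k
        - hankelMatrix u (star (hankelMatrix u (star (hankelMatrix u (star h))))) k) := by
  have hs := summable_quadTerm u h k
  rw [toeplitzOp_hankelMatrix_eq, hankelMatrix_star_toeplitzOp_eq, hankelMatrix_cube_eq,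
    ← (hs.indicator _).tsum_add (hs.indicator _),
    ← ((hs.indicator _).add (hs.indicator _)).tsum_sub (hs.indicator _)]
  refine (tsum_congr fun q => ?_ : _ = ∑' q, quadTerm u h k q) ▸ hankelMatrix_cubic_hasSum u h k
  simp only [Set.indicator_apply, Set.mem_ofPred_eq]
  by_cases h1 : q.1 + 1 ≤ q.2.1 <;> by_cases h2 : k + 1 ≤ q.2.2.2 <;> simp [h1, h2]
  rw [quadTerm, if_neg (by omega)]

theorem star_hankelMatrix (u : Wiener) (h : Hardy) :
    star (hankelMatrix u h) = hankelMatrix (star u) (star h) := by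
  ext k
  refine HasSum.unique ?_ (hankelMatrix_hasSum (star u) (star h) k)
  refine hasSum_of_eq (hankelMatrix_hasSum u h k).star fun ℓ => ?_
  simp

theorem inner_hankelMatrix_star_comm (u : Wiener) (x y : Hardy) :
    inner ℂ x (hankelMatrix u (star y)) = inner ℂ y (hankelMatrix u (star x)) := by
  have key : ∀ x y : Hardy, HasSum (fun m => u m * ∑ k ∈ Finset.range m,
      conj (x k) * conj (y (m - 1 - k))) (inner ℂ x (hankelMatrix u (star y))) := fun x y => by
    have h1 := ((innerSL ℂ x).comp (ContinuousLinearMap.apply ℂ Hardy (star y))).hasSum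
      (superpose_hasSum (fun m => partialReindex (fun k => k + 1 ≤ m) (fun k => m - (k + 1))
        (injOn_sub_right m)) (fun _ => norm_partialReindex_le _ _ _) u)
    refine hasSum_of_eq h1 fun m => ?_
    change _ = inner ℂ x (u m • (partialReindex (fun k => k + 1 ≤ m) (fun k => m - (k + 1))
        (injOn_sub_right m) (star y)))
    rw [inner_smul_right]
    congr 1
    rw [lp.inner_eq_tsum, tsum_eq_sum (s := Finset.range m)]
    · refine Finset.sum_congr rfl fun k hk => ?_
      rw [Finset.mem_range] at hk
      rw [partialReindex_apply, if_pos (by omega), show m - (k + 1) = m - 1 - k by omega]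
      simp [mul_comm]
    · intro k hk
      rw [Finset.mem_range] at hk
      rw [partialReindex_apply, if_neg (by omega), inner_zero_right]
  refine (key x y).unique (hasSum_of_eq (key y x) fun m => ?_)
  rw [← Finset.sum_range_reflect]
  congr 1
  refine Finset.sum_congr rfl fun k hk => ?_
  rw [Finset.mem_range] at hk
  rw [show m - 1 - (m - 1 - k) = k by omega, mul_comm]

/-- The operator `C_u = (i/2) K_u² - i T_{|u|²}` on the Hardy space. -/
def laxOp (u : Wiener) : Hardy →L[ℂ] Hardy :=
  (I / 2) • (hankelMatrix u).comp (hankelMatrix (star u)) - I • toeplitzOp u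

theorem laxOp_apply (u : Wiener) (h : Hardy) :
    laxOp u h = (I / 2) • hankelMatrix u (star (hankelMatrix u (star h))) - I • toeplitzOp u h := by
  rw [star_hankelMatrix, star_star]
  rfl

theorem ku2_eq_hankelMatrix (u : Wiener) (h : Hardy) :
    ku2 u h = hankelMatrix u (star (hankelMatrix u (star h))) := by
  change khankel u (khankel u h) = _
  rw [khankel_eq_hankelMatrix u h, khankel_eq_hankelMatrix]

theorem Cop_eq_laxOp (u : Wiener) (h : Hardy) : Cop u h = laxOp u h := by
  ext k
  rw [laxOp_apply, Cop, ku2_eq_hankelMatrix, toeplitzAbsSq_eq_toeplitzOp]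
  rfl

theorem re_inner_laxOp_self (u : Wiener) (x : Hardy) : (inner ℂ x (laxOp u x)).re = 0 := by
  have h2 : inner ℂ x (toeplitzOp u x) = inner ℂ (mulOp u x) (mulOp u x) :=
    (mulOp u).adjoint_inner_right x (mulOp u x)
  rw [laxOp_apply, inner_sub_right, inner_smul_right, inner_smul_right,
    inner_hankelMatrix_star_comm, h2, inner_self_eq_norm_sq_to_K, inner_self_eq_norm_sq_to_K]
  simp [← ofReal_pow]

theorem laxOp_commutator (u : Wiener) (h : Hardy) :
    laxOp u (hankelMatrix u (star h)) - hankelMatrix u (star (laxOp u h))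
      = (-I) • (toeplitzOp u (hankelMatrix u (star h)) + hankelMatrix u (star (toeplitzOp u h))
        - hankelMatrix u (star (hankelMatrix u (star (hankelMatrix u (star h)))))) := by
  have e : (star (I / 2) : ℂ) = -(I / 2) := by simp [neg_div]
  rw [laxOp_apply, laxOp_apply, star_sub, star_smul, star_smul, map_sub, map_smul, map_smul, e,
    show (star I : ℂ) = -I by simp]
  module

theorem exists_local_propagator (C : ℝ → Hardy →L[ℂ] Hardy) (hC : Continuous C) (t₀ : ℝ) :
    ∃ W : ℝ → Hardy →L[ℂ] Hardy, W t₀ = 1 ∧ ∃ ε > 0, ∀ t ∈ Set.Ioo (t₀ - ε) (t₀ + ε),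
      HasDerivAt W ((C t).comp (W t)) t := by
  set M : ℝ := ‖C t₀‖ + 1 with hM
  have hM0 : 0 < M := by positivity
  obtain ⟨ε₀, hε₀, hb⟩ := Metric.eventually_nhds_iff_ball.1
    (hC.norm.continuousAt.eventually (gt_mem_nhds (by linarith : ‖C t₀‖ < M)))
  set ε : ℝ := min (ε₀ / 2) (1 / (2 * M)) with hε
  have hε1 : 0 < ε := by positivity
  have hCM : ∀ t ∈ Set.Icc (t₀ - ε) (t₀ + ε), ‖C t‖ ≤ M := fun t ht => by
    refine (hb t ?_).le
    rw [Metric.mem_ball, Real.dist_eq, abs_lt]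
    have := min_le_left (ε₀ / 2) (1 / (2 * M))
    constructor <;> linarith [ht.1, ht.2]
  have hP : IsPicardLindelof (fun t X => (C t).comp X) (tmin := t₀ - ε) (tmax := t₀ + ε)
      ⟨t₀, by constructor <;> linarith⟩ (1 : Hardy →L[ℂ] Hardy) 1 0 ⟨2 * M, by positivity⟩
      ⟨M, hM0.le⟩ := by
    refine ⟨fun t ht => ?_, fun X _ => ?_, fun t ht X hX => ?_, ?_⟩
    · refine LipschitzWith.lipschitzOnWith (LipschitzWith.of_dist_le_mul fun X Y => ?_)
      rw [dist_eq_norm, dist_eq_norm, ← ContinuousLinearMap.comp_sub]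
      exact (ContinuousLinearMap.opNorm_comp_le _ _).trans
        (mul_le_mul_of_nonneg_right (hCM t ht) (norm_nonneg _))
    · exact (hC.clm_comp continuous_const).continuousOn
    · refine (ContinuousLinearMap.opNorm_comp_le _ _).trans ?_
      rw [Metric.mem_closedBall, dist_eq_norm] at hX
      have h2 : ‖X‖ ≤ 2 := by
        have h1 : ‖(1 : Hardy →L[ℂ] Hardy)‖ ≤ 1 := ContinuousLinearMap.norm_id_le
        have h3 := norm_add_le (X - 1) 1
        rw [sub_add_cancel] at h3
        simp only [NNReal.coe_one] at hX
        linarith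
      change _ ≤ 2 * M
      nlinarith [hCM t ht, norm_nonneg (C t), norm_nonneg X]
    · change 2 * M * max (t₀ + ε - t₀) (t₀ - (t₀ - ε)) ≤ 1 - 0
      rw [add_sub_cancel_left, sub_sub_cancel, max_self, sub_zero]
      calc 2 * M * ε ≤ 2 * M * (1 / (2 * M)) := by gcongr; exact min_le_right _ _
        _ = 1 := by field_simp
  obtain ⟨W, hW0, hW⟩ := hP.exists_eq_forall_mem_Icc_hasDerivWithinAt₀
  exact ⟨W, hW0, ε, hε1, fun t ht =>
    (hW t (Set.Ioo_subset_Icc_self ht)).hasDerivAt (Icc_mem_nhds ht.1 ht.2)⟩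

theorem real_inner_eq_re (x y : Hardy) : inner ℝ x y = (inner ℂ x y).re := by
  refine (lp.hasSum_inner (𝕜 := ℝ) x y).unique ?_
  exact Complex.reCLM.hasSum (lp.hasSum_inner (𝕜 := ℂ) x y)

theorem norm_eq_of_hasDerivAt_laxOp {U : ℝ → Wiener} {v : ℝ → Hardy} {a b : ℝ}
    (hv : ∀ t ∈ Set.Ioo a b, HasDerivAt v (laxOp (U t) (v t)) t) {s t : ℝ}
    (hs : s ∈ Set.Ioo a b) (ht : t ∈ Set.Ioo a b) : ‖v t‖ = ‖v s‖ := by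
  have h1 : ∀ t ∈ Set.Ioo a b, HasDerivWithinAt (fun t => ‖v t‖ ^ 2) 0 (Set.Ioo a b) t :=
    fun t ht => by
      have h2 := (hv t ht).norm_sq
      rw [real_inner_eq_re, re_inner_laxOp_self, mul_zero] at h2
      exact h2.hasDerivWithinAt
  have h4 := (convex_Ioo a b).norm_image_sub_le_of_norm_hasDerivWithin_le (C := 0) h1
    (fun t _ => by simp) hs ht
  rw [zero_mul, norm_le_zero_iff, sub_eq_zero] at h4
  exact (sq_eq_sq₀ (norm_nonneg _) (norm_nonneg _)).1 h4

theorem continuous_laxOp : Continuous laxOp := by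
  have h1 : Continuous fun u : Wiener => hankelMatrix (star u) := hankelMatrix.continuous.comp
    continuous_star
  have h2 : Continuous toeplitzOp :=
    ((ContinuousLinearMap.adjoint (𝕜 := ℂ) (E := Hardy) (F := Hardy)).continuous.comp
      mulOp.continuous).clm_comp mulOp.continuous
  exact ((hankelMatrix.continuous.clm_comp h1).const_smul (I / 2)).sub (h2.const_smul I)

/-- Along a Lax-pair evolution, the shifted Hankel operators at nearby times are unitarily
equivalent. -/
theorem eventually_exists_unitary {U V : ℝ → Wiener} (hU : ∀ t, HasDerivAt U (V t) t)
    (hV : ∀ t (h : Hardy), hankelMatrix (V t) (star h) =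
      laxOp (U t) (hankelMatrix (U t) (star h)) - hankelMatrix (U t) (star (laxOp (U t) h)))
    (t₀ : ℝ) : ∀ᶠ t in 𝓝 t₀, ∃ W : Hardy ≃ₗᵢ[ℂ] Hardy, ∀ h : Hardy,
      hankelMatrix (U t) (star (W h)) = W (hankelMatrix (U t₀) (star h)) := by
  have hUc : Continuous U := continuous_iff_continuousAt.2 fun t => (hU t).continuousAt
  obtain ⟨W, hW0, ε, hε, hW⟩ := exists_local_propagator _ (continuous_laxOp.comp hUc) t₀
  have ht₀ : t₀ ∈ Set.Ioo (t₀ - ε) (t₀ + ε) := ⟨by linarith, by linarith⟩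
  have hev : ∀ h : Hardy, ∀ t ∈ Set.Ioo (t₀ - ε) (t₀ + ε),
      HasDerivAt (fun t => W t h) (laxOp (U t) (W t h)) t := fun h t ht => by
    have h1 := ((ContinuousLinearMap.apply ℂ Hardy h).restrictScalars ℝ).hasFDerivAt.comp_hasDerivAt
      t (hW t ht)
    exact h1
  have hclose : ∀ᶠ t in 𝓝 t₀, ‖1 - W t‖ < 1 := by
    have h1 : ContinuousAt (fun t => ‖1 - W t‖) t₀ :=
      (continuousAt_const.sub (hW t₀ ht₀).continuousAt).norm
    refine h1.eventually (gt_mem_nhds ?_)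
    simp only [hW0, sub_self, norm_zero]
    exact one_pos
  filter_upwards [hclose, Ioo_mem_nhds ht₀.1 ht₀.2] with t h1 ht
  have hiso : ∀ h, ‖W t h‖ = ‖h‖ := fun h => by
    have := norm_eq_of_hasDerivAt_laxOp (hev h) ht₀ ht
    rwa [hW0] at this
  have hunit : IsUnit (W t) := by
    have := isUnit_one_sub_of_norm_lt_one h1
    rwa [sub_sub_cancel] at this
  have hsurj : Function.Surjective (W t) := by
    obtain ⟨Y, hY⟩ := hunit.exists_right_inv
    exact fun y => ⟨Y y, DFunLike.congr_fun hY y⟩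
  refine ⟨LinearIsometryEquiv.ofSurjective ⟨(W t : Hardy →ₗ[ℂ] Hardy), hiso⟩ hsurj, fun h => ?_⟩
  change hankelMatrix (U t) (star (W t h)) = W t (hankelMatrix (U t₀) (star h))
  have hd : ∀ t ∈ Set.Ioo (t₀ - ε) (t₀ + ε), HasDerivAt
      (fun t => hankelMatrix (U t) (star (W t h)) - W t (hankelMatrix (U t₀) (star h)))
      (laxOp (U t) (hankelMatrix (U t) (star (W t h)) - W t (hankelMatrix (U t₀) (star h)))) t := by
    intro t ht
    have e1 : HasDerivAt (fun t => (hankelMatrix (U t)).restrictScalars ℝ)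
        ((hankelMatrix (V t)).restrictScalars ℝ) t :=
      ((ContinuousLinearMap.restrictScalarsL ℂ Hardy Hardy ℝ ℝ).comp
        (hankelMatrix.restrictScalars ℝ)).hasFDerivAt.comp_hasDerivAt t (hU t)
    have e2 : HasDerivAt (fun t => hankelMatrix (U t) (star (W t h)))
        (hankelMatrix (V t) (star (W t h)) + hankelMatrix (U t) (star (laxOp (U t) (W t h)))) t :=
      e1.clm_apply (hev h t ht).star
    refine (e2.sub (hev _ t ht)).congr_deriv ?_
    rw [hV, map_sub]
    abel
  have h5 := norm_eq_of_hasDerivAt_laxOp hd ht₀ ht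
  rw [hW0] at h5
  simp only [one_apply_eq_self, sub_self, norm_zero, norm_eq_zero] at h5
  exact sub_eq_zero.1 h5

theorem exists_unitary {U V : ℝ → Wiener} (hU : ∀ t, HasDerivAt U (V t) t)
    (hV : ∀ t (h : Hardy), hankelMatrix (V t) (star h) =
      laxOp (U t) (hankelMatrix (U t) (star h)) - hankelMatrix (U t) (star (laxOp (U t) h)))
    (s t : ℝ) : ∃ W : Hardy ≃ₗᵢ[ℂ] Hardy, ∀ h : Hardy,
      hankelMatrix (U t) (star (W h)) = W (hankelMatrix (U s) (star h)) := by
  let S : Set ℝ := {t | ∃ W : Hardy ≃ₗᵢ[ℂ] Hardy, ∀ h : Hardy,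
      hankelMatrix (U t) (star (W h)) = W (hankelMatrix (U s) (star h))}
  have hopen : IsOpen S := isOpen_iff_mem_nhds.2 fun t ⟨W, hW⟩ => by
    filter_upwards [eventually_exists_unitary hU hV t] with r ⟨W', hW'⟩
    exact ⟨W.trans W', fun h => by
      rw [LinearIsometryEquiv.trans_apply, LinearIsometryEquiv.trans_apply, hW', hW]⟩
  have hclosed : IsClosed S := isOpen_compl_iff.1 <| isOpen_iff_mem_nhds.2 fun t ht => by
    filter_upwards [eventually_exists_unitary hU hV t] with r ⟨W', hW'⟩ ⟨W, hW⟩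
    refine ht ⟨W.trans W'.symm, fun h => ?_⟩
    rw [LinearIsometryEquiv.trans_apply, LinearIsometryEquiv.trans_apply,
      LinearIsometryEquiv.eq_symm_apply, ← hW', LinearIsometryEquiv.apply_symm_apply, hW]
  have := IsClopen.eq_univ ⟨hclosed, hopen⟩ ⟨s, LinearIsometryEquiv.refl ℂ Hardy, fun h => rfl⟩
  exact (this ▸ Set.mem_univ t : t ∈ S)

theorem hankelMatrix_flow_eq {α : ℝ} {U V : Wiener}
    (hV : ∀ n, V n = -I * (cubic U n + (α : ℂ) * U 0 * oneSeq n)) (h : Hardy) :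
    hankelMatrix V (star h) =
      laxOp U (hankelMatrix U (star h)) - hankelMatrix U (star (laxOp U h)) := by
  rw [laxOp_commutator]
  ext k
  refine (khankel_hasSum V h k).unique ?_
  refine hasSum_of_eq ((hankelMatrix_cubic_identity U h k).mul_left (-I)) fun ℓ => ?_
  rw [hV, oneSeq, if_neg (by omega)]
  ring

theorem hasDerivAt_khankel {U V : ℝ → Wiener} (hU : ∀ t, HasDerivAt U (V t) t) (h : Hardy)
    (t : ℝ) (k : ℕ) :
    HasDerivAt (fun τ => khankel (U τ) h k) (hankelMatrix (V t) (star h) k) t := by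
  have h1 := ((((lp.evalCLM ℂ (fun _ : ℕ => ℂ) 2 k).comp
    (ContinuousLinearMap.apply ℂ Hardy (star h))).comp hankelMatrix).restrictScalars
      ℝ).hasFDerivAt.comp_hasDerivAt t (hU t)
  refine h1.congr_of_eventuallyEq (Filter.Eventually.of_forall fun τ => ?_)
  change khankel (U τ) h k = hankelMatrix (U τ) (star h) k
  rw [khankel_eq_hankelMatrix]

theorem eigenvalue_of_unitary {u v : Wiener} (W : Hardy ≃ₗᵢ[ℂ] Hardy)
    (hW : ∀ h : Hardy, hankelMatrix v (star (W h)) = W (hankelMatrix u (star h))) {lam : ℂ}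
    (hlam : ∃ h : ℕ → ℂ, MemL2 h ∧ h ≠ 0 ∧ ku2 u h = lam • h) :
    ∃ h : ℕ → ℂ, MemL2 h ∧ h ≠ 0 ∧ ku2 v h = lam • h := by
  obtain ⟨h, hm, h0, he⟩ := hlam
  let x : Hardy := ⟨h, hm⟩
  have hx : hankelMatrix u (star (hankelMatrix u (star x))) = lam • x := by
    ext k
    rw [← ku2_eq_hankelMatrix]
    exact congrFun he k
  refine ⟨W x, lp.memℓp _, fun h1 => h0 ?_, ?_⟩
  · have h2 : W x = 0 := lp.ext h1
    rw [LinearIsometryEquiv.map_eq_zero_iff] at h2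
    exact congrArg (fun y : Hardy => (y : ℕ → ℂ)) h2
  · rw [ku2_eq_hankelMatrix, hW, hW, hx, map_smul]
    rfl

/-- The Lax pair and its consequences for a solution which is a differentiable curve in the
Wiener algebra. -/
theorem lax_pair_of_hasDerivAt {α : ℝ} {u : ℝ → ℕ → ℂ} {U V : ℝ → Wiener}
    (hu : ∀ t, u t = U t) (hU : ∀ t, HasDerivAt U (V t) t)
    (hV : ∀ t n, V t n = -I * (cubic (U t) n + (α : ℂ) * U t 0 * oneSeq n)) :
    (∀ h : ℕ → ℂ, MemL2 h → ∀ t k, HasDerivAt (fun τ => khankel (u τ) h k)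
        (Cop (u t) (khankel (u t) h) k - khankel (u t) (Cop (u t) h) k) t) ∧
    (∀ t, ∃ U : Hardy ≃ₗᵢ[ℂ] Hardy,
      ∀ (h : Hardy) (hm : Memℓp (khankel (u 0) ⇑h) 2) (k : ℕ),
        khankel (u t) (⇑(U h)) k = (U ⟨khankel (u 0) ⇑h, hm⟩) k) ∧
    (∀ t, {lam : ℂ | ∃ h : ℕ → ℂ, MemL2 h ∧ h ≠ 0 ∧ ku2 (u t) h = lam • h} =
          {lam : ℂ | ∃ h : ℕ → ℂ, MemL2 h ∧ h ≠ 0 ∧ ku2 (u 0) h = lam • h}) := by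
  have hflow := fun t h => hankelMatrix_flow_eq (hV t) h
  simp only [hu]
  refine ⟨fun h hm t k => ?_, fun t => ?_, fun t => ?_⟩
  · have h1 := hasDerivAt_khankel hU ⟨h, hm⟩ t k
    rw [hflow] at h1
    change HasDerivAt _ (Cop (U t) (khankel (U t) (⟨h, hm⟩ : Hardy)) k
      - khankel (U t) (Cop (U t) (⟨h, hm⟩ : Hardy)) k) t
    rw [Cop_eq_laxOp, khankel_eq_hankelMatrix, khankel_eq_hankelMatrix, Cop_eq_laxOp]
    exact h1
  · obtain ⟨W, hW⟩ := exists_unitary hU hflow 0 t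
    refine ⟨W, fun h hm k => ?_⟩
    have h1 : (⟨khankel (U 0) h, hm⟩ : Hardy) = hankelMatrix (U 0) (star h) :=
      lp.ext (khankel_eq_hankelMatrix _ _)
    rw [h1, khankel_eq_hankelMatrix, hW]
  · obtain ⟨W, hW⟩ := exists_unitary hU hflow 0 t
    obtain ⟨W', hW'⟩ := exists_unitary hU hflow t 0
    exact Set.ext fun lam => ⟨eigenvalue_of_unitary W' hW', eigenvalue_of_unitary W hW⟩

/-- The Sobolev weight `(1 + n) ^ r`. -/
def weight (r : ℝ) (n : ℕ) : ℝ := (1 + n : ℝ) ^ r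

theorem weight_pos (r : ℝ) (n : ℕ) : 0 < weight r n := Real.rpow_pos_of_pos (by positivity) r

theorem one_add_le_weight_sq {r : ℝ} (hr : 1 / 2 < r) (n : ℕ) : (1 + n : ℝ) ≤ weight r n ^ 2 := by
  rw [weight, ← Real.rpow_natCast, ← Real.rpow_mul (by positivity)]
  refine (Real.rpow_one (1 + n : ℝ)).symm.le.trans ?_
  refine Real.rpow_le_rpow_of_exponent_le (by linarith [Nat.cast_nonneg (α := ℝ) n]) ?_
  push_cast
  linarith

theorem weight_le_add {r : ℝ} (h0 : 0 ≤ r) (h1 : r ≤ 1) {n a c : ℕ} (h : n ≤ a + c) :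
    weight r n ≤ weight r a + weight r c := by
  have h2 : (n : ℝ) ≤ a + c := by exact_mod_cast h
  calc weight r n ≤ ((1 + a : ℝ) + (1 + c)) ^ r :=
        Real.rpow_le_rpow (by positivity) (by linarith) h0
    _ ≤ _ := Real.rpow_add_le_add_rpow (by positivity) (by positivity) h0 h1

/-- The constant `∑ (1 + n) ^ (-(r + 1/2))` of the embedding of the Sobolev space into the
Wiener algebra. -/
def embeddingConst (r : ℝ) : ℝ := ∑' n : ℕ, (1 + n : ℝ) ^ (-(r + 1 / 2))

theorem summable_embeddingConst {r : ℝ} (hr : 1 / 2 < r) :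
    Summable fun n : ℕ => (1 + n : ℝ) ^ (-(r + 1 / 2)) := by
  have h := (summable_nat_add_iff 1).2 (Real.summable_nat_rpow.2 (by linarith : -(r + 1 / 2) < -1))
  refine h.congr fun n => ?_
  push_cast
  rw [add_comm]

theorem embeddingConst_nonneg (r : ℝ) : 0 ≤ embeddingConst r :=
  tsum_nonneg fun n => by positivity

theorem sq_sum_tail_le {r : ℝ} (hr : 1 / 2 < r) (Y : Hardy) (M : ℕ) (s : Finset ℕ)
    (hs : ∀ n ∈ s, M ≤ n) :
    (∑ n ∈ s, (weight r n)⁻¹ * ‖Y n‖) ^ 2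
      ≤ embeddingConst r * (1 + M : ℝ) ^ (-(r - 1 / 2)) * ‖Y‖ ^ 2 := by
  refine (Finset.sum_mul_sq_le_sq_mul_sq s _ _).trans ?_
  refine mul_le_mul ?_ ?_ (Finset.sum_nonneg fun n _ => by positivity)
    (mul_nonneg (embeddingConst_nonneg r) (by positivity))
  · calc ∑ n ∈ s, (weight r n)⁻¹ ^ 2
        ≤ ∑ n ∈ s, (1 + n : ℝ) ^ (-(r + 1 / 2)) * (1 + M : ℝ) ^ (-(r - 1 / 2)) := by
          refine Finset.sum_le_sum fun n hn => ?_
          have h1 : (weight r n)⁻¹ ^ 2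
              = (1 + n : ℝ) ^ (-(r + 1 / 2)) * (1 + n : ℝ) ^ (-(r - 1 / 2)) := by
            rw [weight, ← Real.rpow_neg (by positivity), ← Real.rpow_natCast,
              ← Real.rpow_mul (by positivity), ← Real.rpow_add (by positivity)]
            congr 1
            push_cast
            ring
          rw [h1]
          refine mul_le_mul_of_nonneg_left ?_ (by positivity)
          have h2 : (M : ℝ) ≤ n := by exact_mod_cast hs n hn
          exact Real.rpow_le_rpow_of_nonpos (by positivity) (by linarith) (by linarith)
      _ = (∑ n ∈ s, (1 + n : ℝ) ^ (-(r + 1 / 2))) * (1 + M : ℝ) ^ (-(r - 1 / 2)) :=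
          (Finset.sum_mul _ _ _).symm
      _ ≤ _ := mul_le_mul_of_nonneg_right
          ((summable_embeddingConst hr).sum_le_tsum s fun n _ => by positivity) (by positivity)
  · rw [Y.norm_sq_eq]
    exact Y.summable_norm_sq.sum_le_tsum s fun n _ => by positivity

/-- The Cauchy-Schwarz constant for the modes `n ≥ M`. -/
def tailConst (r : ℝ) (M : ℕ) : ℝ := √(embeddingConst r * (1 + M : ℝ) ^ (-(r - 1 / 2)))

theorem tailConst_nonneg (r : ℝ) (M : ℕ) : 0 ≤ tailConst r M := Real.sqrt_nonneg _

theorem tailConst_sq (r : ℝ) (M : ℕ) :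
    tailConst r M ^ 2 = embeddingConst r * (1 + M : ℝ) ^ (-(r - 1 / 2)) :=
  Real.sq_sqrt (mul_nonneg (embeddingConst_nonneg r) (by positivity))

theorem sum_tail_le {r : ℝ} (hr : 1 / 2 < r) (Y : Hardy) (M : ℕ) (s : Finset ℕ)
    (hs : ∀ n ∈ s, M ≤ n) :
    ∑ n ∈ s, (weight r n)⁻¹ * ‖Y n‖ ≤ tailConst r M * ‖Y‖ := by
  refine (abs_le_of_sq_le_sq' ?_ (mul_nonneg (tailConst_nonneg r M) (norm_nonneg _))).2
  rw [mul_pow, tailConst_sq]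
  exact sq_sum_tail_le hr Y M s hs

theorem summable_weight_inv_mul {r : ℝ} (hr : 1 / 2 < r) (Y : Hardy) :
    Summable fun n => (weight r n)⁻¹ * ‖Y n‖ :=
  summable_of_sum_le (fun n => mul_nonneg (inv_nonneg.2 (weight_pos r n).le) (norm_nonneg _))
    fun s => sum_tail_le hr Y 0 s fun n _ => n.zero_le

theorem norm_unweight_apply (r : ℝ) (Y : Hardy) (n : ℕ) :
    ‖(((weight r n)⁻¹ : ℝ) : ℂ) * Y n‖ = (weight r n)⁻¹ * ‖Y n‖ := by
  rw [norm_mul, Complex.norm_real, Real.norm_of_nonneg (inv_nonneg.2 (weight_pos r n).le)]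

/-- Division by the Sobolev weight, from `ℓ²` to the Wiener algebra. -/
def unweight {r : ℝ} (hr : 1 / 2 < r) : Hardy →L[ℂ] Wiener :=
  have hm : ∀ Y : Hardy, Memℓp (fun n => (((weight r n)⁻¹ : ℝ) : ℂ) * Y n) 1 := fun Y => by
    rw [memℓp_gen_iff (by norm_num)]
    simpa only [norm_unweight_apply, ENNReal.toReal_one, Real.rpow_one] using summable_weight_inv_mul hr Y
  LinearMap.mkContinuous
    { toFun := fun Y => ⟨fun n => (((weight r n)⁻¹ : ℝ) : ℂ) * Y n, hm Y⟩
      map_add' := fun Y Z => lp.ext (funext fun n => mul_add _ _ _)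
      map_smul' := fun c Y => lp.ext (funext fun n => mul_left_comm _ _ _) } (tailConst r 0)
    fun Y => by
      rw [Wiener.norm_eq]
      change ∑' n, ‖(((weight r n)⁻¹ : ℝ) : ℂ) * Y n‖ ≤ _
      simp only [norm_unweight_apply]
      exact Real.tsum_le_of_sum_le (fun n => by have := (weight_pos r n).le; positivity)
        fun s => sum_tail_le hr Y 0 s fun n _ => n.zero_le

theorem unweight_apply {r : ℝ} (hr : 1 / 2 < r) (Y : Hardy) (n : ℕ) :
    unweight hr Y n = (((weight r n)⁻¹ : ℝ) : ℂ) * Y n := rfl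

theorem weight_mul_unweight {r : ℝ} (hr : 1 / 2 < r) (Y : Hardy) (n : ℕ) :
    (weight r n : ℂ) * unweight hr Y n = Y n := by
  rw [unweight_apply, ← mul_assoc, ← ofReal_mul, mul_inv_cancel₀ (weight_pos r n).ne', ofReal_one,
    one_mul]

theorem norm_unweight_le {r : ℝ} (hr : 1 / 2 < r) (Y : Hardy) (M : ℕ) :
    ‖unweight hr Y‖ ≤ ∑ n ∈ Finset.range M, ‖unweight hr Y n‖ + tailConst r M * ‖Y‖ := by
  rw [Wiener.norm_eq, ← (unweight hr Y).summable_norm.sum_add_tsum_nat_add M]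
  gcongr
  refine Real.tsum_le_of_sum_le (fun n => norm_nonneg _) fun s => ?_
  simp only [unweight_apply, norm_unweight_apply]
  have h1 := sum_tail_le hr Y M (s.map (addRightEmbedding M)) fun n hn => by
    obtain ⟨k, -, rfl⟩ := Finset.mem_map.1 hn
    exact Nat.le_add_left _ _
  rw [Finset.sum_map] at h1
  exact h1

theorem tendsto_tailConst {r : ℝ} (hr : 1 / 2 < r) : Tendsto (tailConst r) atTop (𝓝 0) := by
  have h1 : Tendsto (fun M : ℕ => (1 + M : ℝ) ^ (-(r - 1 / 2))) atTop (𝓝 0) :=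
    (tendsto_rpow_neg_atTop (by linarith)).comp
      (tendsto_atTop_add_const_left _ _ tendsto_natCast_atTop_atTop)
  have h2 := (h1.const_mul (embeddingConst r)).sqrt
  rwa [mul_zero, Real.sqrt_zero] at h2

/-- Coordinatewise continuity and local boundedness in the Sobolev space give continuity in the
Wiener algebra. -/
theorem continuous_unweight_comp {r : ℝ} (hr : 1 / 2 < r) {G : ℝ → Hardy}
    (hG : ∀ n, Continuous fun t => G t n) (hb : ∀ t₀, ∃ R, ∀ᶠ t in 𝓝 t₀, ‖G t‖ ≤ R) :
    Continuous fun t => unweight hr (G t) := by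
  refine continuous_iff_continuousAt.2 fun t₀ => ?_
  obtain ⟨R, hR⟩ := hb t₀
  have hR0 : 0 ≤ R := (norm_nonneg _).trans hR.self_of_nhds
  refine Metric.tendsto_nhds.2 fun ε hε => ?_
  obtain ⟨M, hM⟩ := (((tendsto_tailConst hr).mul_const (2 * R)).eventually
    (gt_mem_nhds (by rw [zero_mul]; exact half_pos hε : 0 * (2 * R) < ε / 2))).exists
  have h1 : Tendsto (fun t => ∑ n ∈ Finset.range M, ‖unweight hr (G t - G t₀) n‖) (𝓝 t₀) (𝓝 0) := by
    have h2 : Continuous fun t => ∑ n ∈ Finset.range M, ‖unweight hr (G t - G t₀) n‖ := by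
      refine continuous_finsetSum _ fun n _ => ?_
      exact (continuous_const.mul ((hG n).sub continuous_const)).norm
    have h3 := h2.tendsto t₀
    simpa using h3
  filter_upwards [hR, h1.eventually (gt_mem_nhds (half_pos hε))] with t ht ht'
  rw [dist_eq_norm, ← map_sub]
  refine (norm_unweight_le hr _ M).trans_lt ?_
  have h4 : ‖G t - G t₀‖ ≤ 2 * R := by
    have := norm_sub_le (G t) (G t₀)
    linarith [hR.self_of_nhds]
  have h5 : tailConst r M * ‖G t - G t₀‖ ≤ tailConst r M * (2 * R) :=
    mul_le_mul_of_nonneg_left h4 (tailConst_nonneg r M)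
  linarith

/-- The sequence of moduli of an element of the Wiener algebra. -/
def wienerModulus (u : Wiener) : Wiener :=
  ⟨fun n => (‖u n‖ : ℂ), Memℓp.mono' (E := fun _ : ℕ => ℂ) (F := fun _ : ℕ => ℂ) (lp.memℓp u)
    fun n => by rw [Complex.norm_real, norm_norm]⟩

/-- The sequence of moduli of an element of the Hardy space. -/
def hardyModulus (x : Hardy) : Hardy :=
  ⟨fun n => (‖x n‖ : ℂ), Memℓp.mono' (E := fun _ : ℕ => ℂ) (F := fun _ : ℕ => ℂ) (lp.memℓp x)
    fun n => by rw [Complex.norm_real, norm_norm]⟩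

theorem wienerModulus_apply (u : Wiener) (n : ℕ) : wienerModulus u n = (‖u n‖ : ℂ) := rfl

theorem hardyModulus_apply (x : Hardy) (n : ℕ) : hardyModulus x n = (‖x n‖ : ℂ) := rfl

theorem norm_wienerModulus (u : Wiener) : ‖wienerModulus u‖ = ‖u‖ := by
  rw [Wiener.norm_eq, Wiener.norm_eq]
  simp [wienerModulus_apply]

theorem norm_hardyModulus (x : Hardy) : ‖hardyModulus x‖ = ‖x‖ := by
  rw [← sq_eq_sq₀ (norm_nonneg _) (norm_nonneg _), Hardy.norm_sq_eq, Hardy.norm_sq_eq]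
  simp [hardyModulus_apply]

theorem norm_toeplitzOp_le (u : Wiener) (x : Hardy) : ‖toeplitzOp u x‖ ≤ ‖u‖ ^ 2 * ‖x‖ := by
  have h1 : ‖toeplitzOp u‖ ≤ ‖u‖ * ‖u‖ := by
    refine (ContinuousLinearMap.opNorm_comp_le _ _).trans ?_
    rw [LinearIsometryEquiv.norm_map]
    exact mul_le_mul (norm_mulOp_le u) (norm_mulOp_le u) (norm_nonneg _) (norm_nonneg _)
  refine ((toeplitzOp u).le_opNorm x).trans ?_
  rw [sq]
  exact mul_le_mul_of_nonneg_right h1 (norm_nonneg _)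

/-- The moduli of the terms of the cubic sum. -/
def cubicMajorant (u : ℕ → ℂ) (n : ℕ) (q : ℕ × ℕ × ℕ) : ℝ :=
  if q.1 + q.2.2 = q.2.1 + n then ‖u q.1‖ * ‖u q.2.1‖ * ‖u q.2.2‖ else 0

theorem cubicMajorant_nonneg (u : ℕ → ℂ) (n : ℕ) (q : ℕ × ℕ × ℕ) : 0 ≤ cubicMajorant u n q := by
  rw [cubicMajorant]
  split_ifs <;> positivity

theorem weight_mul_norm_unweight {r : ℝ} (hr : 1 / 2 < r) (Y : Hardy) (n : ℕ) :
    weight r n * ‖unweight hr Y n‖ = ‖Y n‖ := by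
  rw [← weight_mul_unweight hr Y n, norm_mul, Complex.norm_real,
    Real.norm_of_nonneg (weight_pos r n).le]

theorem summable_cubicMajorant_and_le {r : ℝ} (hr : 1 / 2 < r) (hr1 : r ≤ 1) (Y : Hardy) (n : ℕ) :
    Summable (cubicMajorant (unweight hr Y) n) ∧
      weight r n * ∑' q, cubicMajorant (unweight hr Y) n q
        ≤ 2 * ‖toeplitzOp (wienerModulus (unweight hr Y)) (hardyModulus Y) n‖ := by
  set u := unweight hr Y
  let f : ℕ × ℕ × ℕ → ℝ := fun q =>
    if q.1 + q.2.2 = q.2.1 + n then ‖Y q.1‖ * (‖u q.2.1‖ * ‖u q.2.2‖) else 0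
  have hf : HasSum f (toeplitzOp (wienerModulus u) (hardyModulus Y) n).re := by
    have h1 := Complex.reCLM.hasSum (toeplitzOp_hasSum (wienerModulus u) (hardyModulus Y) n)
    refine (funext fun q => ?_ : f = _) ▸ h1
    change _ = Complex.re (if q.1 + q.2.2 = q.2.1 + n then
      (‖Y q.1‖ : ℂ) * (conj (‖u q.2.1‖ : ℂ) * (‖u q.2.2‖ : ℂ)) else 0)
    simp only [f]
    split_ifs
    · rw [Complex.conj_ofReal, ← ofReal_mul, ← ofReal_mul, ofReal_re]
    · rfl
  let e : ℕ × ℕ × ℕ ≃ ℕ × ℕ × ℕ :=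
    ⟨fun q => (q.2.2, q.2.1, q.1), fun q => (q.2.2, q.2.1, q.1), fun _ => rfl, fun _ => rfl⟩
  have hf2 := hf.add (e.hasSum_iff.2 hf)
  have hle : ∀ q, weight r n * cubicMajorant u n q ≤ f q + (f ∘ e) q := fun q => by
    change _ ≤ f q + f (q.2.2, q.2.1, q.1)
    simp only [cubicMajorant, f]
    by_cases hq : q.1 + q.2.2 = q.2.1 + n
    · rw [if_pos hq, if_pos hq, if_pos (by omega), ← weight_mul_norm_unweight hr Y q.1,
        ← weight_mul_norm_unweight hr Y q.2.2]
      have h1 := weight_le_add (by linarith) hr1 (by omega : n ≤ q.1 + q.2.2)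
      have h2 := mul_le_mul_of_nonneg_right h1
        (by positivity : 0 ≤ ‖u q.1‖ * ‖u q.2.1‖ * ‖u q.2.2‖)
      refine h2.trans_eq ?_
      ring
    · rw [if_neg hq, if_neg hq, if_neg (by omega)]
      simp
  have hs : Summable fun q => weight r n * cubicMajorant u n q :=
    Summable.of_nonneg_of_le
      (fun q => mul_nonneg (weight_pos r n).le (cubicMajorant_nonneg _ _ _)) hle hf2.summable
  refine ⟨(summable_mul_left_iff (weight_pos r n).ne').1 hs, ?_⟩
  rw [← tsum_mul_left, two_mul]
  refine (hasSum_le hle hs.hasSum hf2).trans ?_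
  gcongr <;> exact Complex.re_le_norm _

theorem norm_cubic_term (u : ℕ → ℂ) (n : ℕ) (q : ℕ × ℕ × ℕ) :
    ‖if q.1 + q.2.2 = q.2.1 + n then u q.1 * conj (u q.2.1) * u q.2.2 else 0‖
      = cubicMajorant u n q := by
  rw [cubicMajorant]
  split_ifs <;> simp

theorem weight_mul_norm_cubic_le {r : ℝ} (hr : 1 / 2 < r) (hr1 : r ≤ 1) (Y : Hardy) (n : ℕ) :
    weight r n * ‖cubic (unweight hr Y) n‖
      ≤ 2 * ‖toeplitzOp (wienerModulus (unweight hr Y)) (hardyModulus Y) n‖ := by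
  obtain ⟨h1, h2⟩ := summable_cubicMajorant_and_le hr hr1 Y n
  refine (mul_le_mul_of_nonneg_left ?_ (weight_pos r n).le).trans h2
  exact tsum_of_norm_bounded h1.hasSum fun q => (norm_cubic_term _ n q).le

theorem norm_weighted_cubic_le_norm {r : ℝ} (hr : 1 / 2 < r) (hr1 : r ≤ 1) (Y : Hardy) (n : ℕ) :
    ‖(weight r n : ℂ) * cubic (unweight hr Y) n‖
      ≤ ‖((2 : ℂ) • toeplitzOp (wienerModulus (unweight hr Y)) (hardyModulus Y)) n‖ := by
  change _ ≤ ‖(2 : ℂ) * toeplitzOp (wienerModulus (unweight hr Y)) (hardyModulus Y) n‖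
  rw [norm_mul, norm_mul, Complex.norm_real, Real.norm_of_nonneg (weight_pos r n).le,
    Complex.norm_ofNat]
  exact weight_mul_norm_cubic_le hr hr1 Y n

/-- The weighted cubic nonlinearity. -/
def weightedCubic {r : ℝ} (hr : 1 / 2 < r) (hr1 : r ≤ 1) (Y : Hardy) : Hardy :=
  ⟨fun n => (weight r n : ℂ) * cubic (unweight hr Y) n,
    Memℓp.mono' (E := fun _ : ℕ => ℂ) (F := fun _ : ℕ => ℂ)
      (lp.memℓp ((2 : ℂ) • toeplitzOp (wienerModulus (unweight hr Y)) (hardyModulus Y)))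
      (norm_weighted_cubic_le_norm hr hr1 Y)⟩

theorem norm_toeplitz_modulus_le {r : ℝ} (hr : 1 / 2 < r) (Y : Hardy) :
    ‖toeplitzOp (wienerModulus (unweight hr Y)) (hardyModulus Y)‖ ≤ ‖unweight hr Y‖ ^ 2 * ‖Y‖ := by
  refine (norm_toeplitzOp_le _ _).trans_eq ?_
  rw [norm_wienerModulus, norm_hardyModulus]

theorem norm_weightedCubic_le {r : ℝ} (hr : 1 / 2 < r) (hr1 : r ≤ 1) (Y : Hardy) :
    ‖weightedCubic hr hr1 Y‖ ≤ 2 * ‖unweight hr Y‖ ^ 2 * ‖Y‖ := by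
  refine (lp.norm_mono (by norm_num) (norm_weighted_cubic_le_norm hr hr1 Y)).trans ?_
  rw [norm_smul, Complex.norm_ofNat, mul_assoc]
  exact mul_le_mul_of_nonneg_left (norm_toeplitz_modulus_le hr Y) zero_le_two

/-- The vector field of the flow in the weighted space. -/
def weightedField {r : ℝ} (hr : 1 / 2 < r) (hr1 : r ≤ 1) (α : ℝ) (Y : Hardy) : Hardy :=
  (-I) • (weightedCubic hr hr1 Y + (α : ℂ) • lp.single 2 0 (Y 0))

theorem norm_weightedField_le {r : ℝ} (hr : 1 / 2 < r) (hr1 : r ≤ 1) (α : ℝ) (Y : Hardy) :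
    ‖weightedField hr hr1 α Y‖ ≤ (2 * ‖unweight hr Y‖ ^ 2 + |α|) * ‖Y‖ := by
  rw [weightedField, norm_smul, norm_neg, Complex.norm_I, one_mul, add_mul]
  refine (norm_add_le _ _).trans (add_le_add (norm_weightedCubic_le hr hr1 Y) ?_)
  rw [norm_smul, lp.norm_single (by norm_num), Complex.norm_real, Real.norm_eq_abs]
  exact mul_le_mul_of_nonneg_left (lp.norm_apply_le_norm (by norm_num) Y 0) (abs_nonneg α)

theorem weightedField_apply {r : ℝ} (hr : 1 / 2 < r) (hr1 : r ≤ 1) (α : ℝ) (Y : Hardy) (n : ℕ) :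
    weightedField hr hr1 α Y n = (weight r n : ℂ) *
      (-I * (cubic (unweight hr Y) n + (α : ℂ) * unweight hr Y 0 * oneSeq n)) := by
  have h0 : weight r 0 = 1 := by simp [weight]
  have h1 := weight_mul_unweight hr Y 0
  rw [h0, ofReal_one, one_mul] at h1
  change -I * ((weight r n : ℂ) * cubic (unweight hr Y) n
    + (α : ℂ) * (lp.single 2 0 (Y 0) : Hardy) n) = _
  rw [oneSeq, h1]
  by_cases hn : n = 0
  · subst hn
    rw [lp.single_apply_self, if_pos rfl, h0]
    push_cast
    ring
  · rw [lp.single_apply_ne _ _ _ hn, if_neg hn]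
    ring

/-- The terms of the quartic form `(Π(|u|²u) | u)`. -/
def quarticTerm (u : ℕ → ℂ) (p : ℕ × ℕ × ℕ × ℕ) : ℂ :=
  conj (u p.1) * if p.2.1 + p.2.2.2 = p.2.2.1 + p.1 then
    u p.2.1 * conj (u p.2.2.1) * u p.2.2.2 else 0

theorem norm_quarticTerm (u : ℕ → ℂ) (p : ℕ × ℕ × ℕ × ℕ) :
    ‖quarticTerm u p‖ = ‖u p.1‖ * cubicMajorant u p.1 p.2 := by
  rw [quarticTerm, norm_mul, norm_cubic_term, RCLike.norm_conj]

theorem summable_mul_norm_toeplitz {r : ℝ} (hr : 1 / 2 < r) (Y : Hardy) :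
    (Summable fun n => ‖Y n‖ *
      (2 * ‖toeplitzOp (wienerModulus (unweight hr Y)) (hardyModulus Y) n‖)) ∧
    ∑' n, ‖Y n‖ * (2 * ‖toeplitzOp (wienerModulus (unweight hr Y)) (hardyModulus Y) n‖)
      ≤ 2 * ‖unweight hr Y‖ ^ 2 * ‖Y‖ ^ 2 := by
  set T := toeplitzOp (wienerModulus (unweight hr Y)) (hardyModulus Y)
  have hfin : ∀ s : Finset ℕ, ∑ n ∈ s, ‖Y n‖ * (2 * ‖T n‖)
      ≤ 2 * ‖unweight hr Y‖ ^ 2 * ‖Y‖ ^ 2 := fun s => by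
    have h1 : ∑ n ∈ s, ‖Y n‖ * ‖T n‖ ≤ ‖Y‖ * ‖T‖ := by
      refine (abs_le_of_sq_le_sq' ?_ (mul_nonneg (norm_nonneg _) (norm_nonneg _))).2
      refine (Finset.sum_mul_sq_le_sq_mul_sq s _ _).trans ?_
      rw [mul_pow, Y.norm_sq_eq, T.norm_sq_eq]
      exact mul_le_mul (Y.summable_norm_sq.sum_le_tsum s fun n _ => by positivity)
        (T.summable_norm_sq.sum_le_tsum s fun n _ => by positivity)
        (Finset.sum_nonneg fun n _ => by positivity) (tsum_nonneg fun n => by positivity)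
    have h2 : ‖Y‖ * ‖T‖ ≤ ‖Y‖ * (‖unweight hr Y‖ ^ 2 * ‖Y‖) :=
      mul_le_mul_of_nonneg_left (norm_toeplitz_modulus_le hr Y) (norm_nonneg _)
    calc ∑ n ∈ s, ‖Y n‖ * (2 * ‖T n‖) = 2 * ∑ n ∈ s, ‖Y n‖ * ‖T n‖ := by
          rw [Finset.mul_sum]
          exact Finset.sum_congr rfl fun n _ => by ring
      _ ≤ 2 * (‖Y‖ * (‖unweight hr Y‖ ^ 2 * ‖Y‖)) := by linarith
      _ = _ := by ring
  exact ⟨summable_of_sum_le (fun n => by positivity) hfin,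
    Real.tsum_le_of_sum_le (fun n => by positivity) hfin⟩

theorem one_add_mul_norm_mul_le {r : ℝ} (hr : 1 / 2 < r) (Y : Hardy) (n : ℕ) {x y : ℝ}
    (hx : 0 ≤ x) (hxy : weight r n * x ≤ y) :
    (1 + n : ℝ) * (‖unweight hr Y n‖ * x) ≤ ‖Y n‖ * y := by
  have hw := (weight_pos r n).le
  calc (1 + n : ℝ) * (‖unweight hr Y n‖ * x)
      ≤ weight r n ^ 2 * (‖unweight hr Y n‖ * x) :=
        mul_le_mul_of_nonneg_right (one_add_le_weight_sq hr n) (by positivity)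
    _ = ‖Y n‖ * (weight r n * x) := by rw [← weight_mul_norm_unweight hr Y n]; ring
    _ ≤ ‖Y n‖ * y := mul_le_mul_of_nonneg_left hxy (norm_nonneg _)

theorem summable_quarticTerm {r : ℝ} (hr : 1 / 2 < r) (hr1 : r ≤ 1) (Y : Hardy) :
    Summable fun p : ℕ × ℕ × ℕ × ℕ => (1 + p.1 : ℂ) * quarticTerm (unweight hr Y) p := by
  set u := unweight hr Y
  have hn : ∀ p : ℕ × ℕ × ℕ × ℕ, ‖(1 + p.1 : ℂ) * quarticTerm u p‖
      = (1 + p.1 : ℝ) * (‖u p.1‖ * cubicMajorant u p.1 p.2) := fun p => by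
    rw [norm_mul, norm_quarticTerm]
    congr 1
    exact_mod_cast Complex.norm_natCast (1 + p.1)
  refine Summable.of_norm ?_
  simp only [hn]
  have hcm := fun n => summable_cubicMajorant_and_le hr hr1 Y n
  refine (summable_prod_of_nonneg fun p => ?_).2 ⟨fun n => ?_, ?_⟩
  · have := cubicMajorant_nonneg u p.1 p.2
    change 0 ≤ _
    positivity
  · change Summable fun q => (1 + n : ℝ) * (‖u n‖ * cubicMajorant u n q)
    exact ((hcm n).1.mul_left _).mul_left _
  · refine Summable.of_nonneg_of_le (fun n => tsum_nonneg fun q => ?_) (fun n => ?_)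
      (summable_mul_norm_toeplitz hr Y).1
    · have := cubicMajorant_nonneg u n q
      change 0 ≤ (1 + n : ℝ) * (‖u n‖ * cubicMajorant u n q)
      positivity
    · change ∑' q, (1 + n : ℝ) * (‖u n‖ * cubicMajorant u n q) ≤ _
      rw [tsum_mul_left, tsum_mul_left]
      exact one_add_mul_norm_mul_le hr Y n (tsum_nonneg fun q => cubicMajorant_nonneg _ _ _)
        (hcm n).2

/-- The `H^{1/2}` energy flux of the cubic nonlinearity vanishes. -/
theorem energy_flux {r : ℝ} (hr : 1 / 2 < r) (hr1 : r ≤ 1) (Y : Hardy) :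
    HasSum (fun n : ℕ => (1 + n : ℝ) * (conj (unweight hr Y n) * cubic (unweight hr Y) n).im) 0 := by
  set u := unweight hr Y with hu
  set Q := quarticTerm u
  have hs := summable_quarticTerm hr hr1 Y
  rw [← hu] at hs
  let e₁ : ℕ × ℕ × ℕ × ℕ ≃ ℕ × ℕ × ℕ × ℕ :=
    ⟨fun p => (p.2.2.1, p.2.1, p.1, p.2.2.2), fun p => (p.2.2.1, p.2.1, p.1, p.2.2.2),
      fun _ => rfl, fun _ => rfl⟩
  let e₂ : ℕ × ℕ × ℕ × ℕ ≃ ℕ × ℕ × ℕ × ℕ :=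
    ⟨fun p => (p.2.1, p.1, p.2.2.2, p.2.2.1), fun p => (p.2.1, p.1, p.2.2.2, p.2.2.1),
      fun _ => rfl, fun _ => rfl⟩
  have hQ₁ : ∀ p, Q (e₁ p) = Q p := fun p => by
    change quarticTerm u (p.2.2.1, p.2.1, p.1, p.2.2.2) = quarticTerm u p
    simp only [quarticTerm]
    by_cases h : p.2.1 + p.2.2.2 = p.2.2.1 + p.1
    · rw [if_pos h, if_pos (by omega)]
      ring
    · rw [if_neg h, if_neg (by omega), mul_zero, mul_zero]
  have hQ₂ : ∀ p, Q (e₂ p) = conj (Q p) := fun p => by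
    change quarticTerm u (p.2.1, p.1, p.2.2.2, p.2.2.1) = conj (quarticTerm u p)
    simp only [quarticTerm]
    by_cases h : p.2.1 + p.2.2.2 = p.2.2.1 + p.1
    · rw [if_pos h, if_pos (by omega)]
      simp only [map_mul, Complex.conj_conj]
      ring
    · rw [if_neg h, if_neg (by omega), mul_zero, mul_zero, map_zero]
  set S := ∑' p : ℕ × ℕ × ℕ × ℕ, (1 + p.1 : ℂ) * Q p
  have h1 : HasSum (fun p : ℕ × ℕ × ℕ × ℕ => (1 + p.1 : ℂ) * Q p) S := hs.hasSum
  have h2 : HasSum (fun p : ℕ × ℕ × ℕ × ℕ => (2 + p.1 + p.2.2.1 : ℂ) * Q p) (S + S) := by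
    refine hasSum_of_eq (h1.add (e₁.hasSum_iff.2 h1)) fun p => ?_
    change _ = _ + (1 + (p.2.2.1 : ℂ)) * Q (e₁ p)
    rw [hQ₁]
    ring
  have h3 : HasSum (fun p : ℕ × ℕ × ℕ × ℕ => (2 + p.1 + p.2.2.1 : ℂ) * Q p) (conj (S + S)) := by
    rw [← e₂.hasSum_iff]
    refine hasSum_of_eq h2.star fun p => ?_
    change (2 + (p.2.1 : ℂ) + p.2.2.2) * Q (e₂ p) = _
    rw [hQ₂]
    simp only [RCLike.star_def, map_mul, map_add, map_natCast, map_ofNat]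
    by_cases h : p.2.1 + p.2.2.2 = p.2.2.1 + p.1
    · have h' : (p.2.1 + p.2.2.2 : ℂ) = p.2.2.1 + p.1 := by exact_mod_cast h
      rw [add_assoc 2, h']
      ring
    · have h0 : Q p = 0 := by
        change quarticTerm u p = 0
        rw [quarticTerm, if_neg h, mul_zero]
      rw [h0, map_zero, mul_zero, mul_zero]
  have h4 : S.im = 0 := by
    have h5 := congrArg Complex.im (h2.unique h3)
    simp only [add_im, conj_im] at h5
    linarith
  have h6 : HasSum (fun n : ℕ => (1 + n : ℂ) * (conj (u n) * cubic u n)) S := by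
    refine h1.prod_fiberwise fun n => ?_
    have h7 := (summable_cubicMajorant_and_le hr hr1 Y n).1
    have h8 : HasSum (fun q : ℕ × ℕ × ℕ =>
        if q.1 + q.2.2 = q.2.1 + n then u q.1 * conj (u q.2.1) * u q.2.2 else 0) (cubic u n) :=
      (Summable.of_norm_bounded h7 fun q => (norm_cubic_term _ n q).le).hasSum
    exact (h8.mul_left _).mul_left _
  have h9 := Complex.imCLM.hasSum h6
  rw [Complex.imCLM_apply, h4] at h9
  refine (funext fun n => ?_ : (fun n : ℕ => (1 + n : ℝ) * (conj (u n) * cubic u n).im) = _) ▸ h9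
  change _ = ((1 + n : ℂ) * (conj (u n) * cubic u n)).im
  rw [show (1 + n : ℂ) = ((1 + n : ℝ) : ℂ) by push_cast; rfl, Complex.im_ofReal_mul]

/-- The truncated energy flux decays uniformly on bounded sets of the Sobolev space. -/
theorem abs_truncated_flux_le {r : ℝ} (hr : 1 / 2 < r) (hr1 : r ≤ 1) (Y : Hardy) (M : ℕ) :
    |∑ n ∈ Finset.range M,
      (1 + n : ℝ) * (conj (unweight hr Y n) * cubic (unweight hr Y) n).im|
      ≤ (1 + M : ℝ) ^ (-(2 * r - 1)) * (2 * ‖unweight hr Y‖ ^ 2 * ‖Y‖ ^ 2) := by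
  set u := unweight hr Y
  obtain ⟨hT, hT'⟩ := summable_mul_norm_toeplitz hr Y
  set T := toeplitzOp (wienerModulus u) (hardyModulus Y)
  have h1 := energy_flux hr hr1 Y
  have h2 := h1.summable.sum_add_tsum_nat_add M
  rw [h1.tsum_eq] at h2
  rw [eq_neg_of_add_eq_zero_left h2, abs_neg, ← Real.norm_eq_abs]
  have h3 := ((summable_nat_add_iff M).2 hT).hasSum.mul_left ((1 + M : ℝ) ^ (-(2 * r - 1)))
  refine (tsum_of_norm_bounded h3 fun n => ?_).trans ?_
  · have h4 : (1 + (n + M : ℕ) : ℝ) ≤ (1 + M : ℝ) ^ (-(2 * r - 1)) * weight r (n + M) ^ 2 := by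
      have h5 : (1 + (n + M : ℕ) : ℝ)
          = (1 + (n + M : ℕ) : ℝ) ^ (-(2 * r - 1)) * weight r (n + M) ^ 2 := by
        rw [weight, ← Real.rpow_natCast, ← Real.rpow_mul (by positivity),
          ← Real.rpow_add (by positivity)]
        refine (Real.rpow_one _).symm.trans ?_
        congr 1
        push_cast
        ring
      refine h5.le.trans (mul_le_mul_of_nonneg_right ?_ (by positivity))
      refine Real.rpow_le_rpow_of_nonpos (by positivity) ?_ (by linarith)
      push_cast
      linarith [Nat.cast_nonneg (α := ℝ) n]
    rw [norm_mul, Real.norm_of_nonneg (by positivity)]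
    have h6 : ‖(conj (u (n + M)) * cubic u (n + M)).im‖ ≤ ‖u (n + M)‖ * ‖cubic u (n + M)‖ := by
      rw [Real.norm_eq_abs]
      refine (Complex.abs_im_le_norm _).trans_eq ?_
      rw [norm_mul, RCLike.norm_conj]
    have h7 := weight_mul_norm_cubic_le hr hr1 Y (n + M)
    have hw := (weight_pos r (n + M)).le
    calc (1 + (n + M : ℕ) : ℝ) * ‖(conj (u (n + M)) * cubic u (n + M)).im‖
        ≤ ((1 + M : ℝ) ^ (-(2 * r - 1)) * weight r (n + M) ^ 2)
            * (‖u (n + M)‖ * ‖cubic u (n + M)‖) :=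
          mul_le_mul h4 h6 (norm_nonneg _) (by positivity)
      _ = (1 + M : ℝ) ^ (-(2 * r - 1)) * (‖Y (n + M)‖ *
            (weight r (n + M) * ‖cubic u (n + M)‖)) := by
          rw [← weight_mul_norm_unweight hr Y (n + M)]
          ring
      _ ≤ _ := by
          refine mul_le_mul_of_nonneg_left ?_ (by positivity)
          exact mul_le_mul_of_nonneg_left h7 (norm_nonneg _)
  · refine mul_le_mul_of_nonneg_left (le_trans ?_ hT') (by positivity)
    rw [← hT.sum_add_tsum_nat_add M]
    exact le_add_of_nonneg_left (Finset.sum_nonneg fun n _ => by positivity)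

/-- A size `N` and a conserved quantity `E` along a curve, such that `N` is controlled for a time
depending only on `E` as long as it is known to be bounded. -/
structure AprioriBound (N E δ Φ : ℝ → ℝ) : Prop where
  isClosed_le : ∀ m, IsClosed {t | N t ≤ m}
  pos : ∀ e, 0 < δ e
  conserved : ∀ a b R, (∀ t ∈ Set.uIcc a b, N t ≤ R) → E a = E b
  le_of_le : ∀ t m, N t ≤ m → E t ≤ m ^ 2
  bound : ∀ a b e m R, E a ≤ e → N a ≤ m → |b - a| ≤ δ e → (∀ t ∈ Set.uIcc a b, N t ≤ R) →
    N b ≤ Φ m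

namespace AprioriBound

variable {N E δ Φ : ℝ → ℝ}

theorem comp_neg (H : AprioriBound N E δ Φ) :
    AprioriBound (fun t => N (-t)) (fun t => E (-t)) δ Φ := by
  have hm : ∀ {a b R : ℝ}, (∀ t ∈ Set.uIcc a b, N (-t) ≤ R) →
      ∀ t ∈ Set.uIcc (-a) (-b), N t ≤ R := fun {a b R} h t ht => by
    have h1 : -t ∈ Set.uIcc a b := by
      rw [Set.mem_uIcc] at ht ⊢
      rcases ht with h | h
      · exact Or.inr ⟨by linarith, by linarith⟩
      · exact Or.inl ⟨by linarith, by linarith⟩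
    simpa using h (-t) h1
  refine ⟨fun m => (H.isClosed_le m).preimage continuous_neg, H.pos,
    fun a b R h => H.conserved _ _ R (hm h), fun t m => H.le_of_le _ m,
    fun a b e m R he hN hd h => H.bound _ _ e m R he hN ?_ (hm h)⟩
  rwa [show -b - -a = -(b - a) by ring, abs_neg]

theorem exists_bound_of_isCompact {K : Set ℝ} (hK : IsCompact K)
    (h : ∀ t ∈ K, ∃ R, ∀ᶠ x in 𝓝 t, N x ≤ R) : ∃ R, ∀ t ∈ K, N t ≤ R := by
  refine hK.induction_on (p := fun s => ∃ R, ∀ t ∈ s, N t ≤ R) ⟨0, by simp⟩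
    (fun s t hst ⟨R, hR⟩ => ⟨R, fun x hx => hR x (hst hx)⟩)
    (fun s t ⟨R, hR⟩ ⟨R', hR'⟩ => ⟨max R R', fun x hx => ?_⟩) fun x hx => ?_
  · rcases hx with hx | hx
    · exact (hR x hx).trans (le_max_left _ _)
    · exact (hR' x hx).trans (le_max_right _ _)
  · obtain ⟨R, hR⟩ := h x hx
    exact ⟨_, mem_nhdsWithin_of_mem_nhds hR, R, fun t ht => ht⟩

theorem le_of_lt (H : AprioriBound N E δ Φ) {a t m : ℝ} (hat : a < t)
    (hloc : ∀ x ∈ Set.Ioc a t, ∃ R, ∀ᶠ y in 𝓝 x, N y ≤ R) (ha : N a ≤ m)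
    (hd : t - a ≤ δ (m ^ 2)) : N t ≤ Φ m := by
  have hb : ∀ x ∈ Set.Ioc a t, ∃ R, ∀ y ∈ Set.Icc x t, N y ≤ R := fun x hx =>
    exists_bound_of_isCompact isCompact_Icc fun y hy => hloc y ⟨hx.1.trans_le hy.1, hy.2⟩
  have hE : ∀ x ∈ Set.Ioc a t, E x = E t := fun x hx => by
    obtain ⟨R, hR⟩ := hb x hx
    exact H.conserved x t R fun y hy => hR y (by rwa [Set.uIcc_of_le hx.2] at hy)
  have hδ := H.pos (E t)
  set t₁ := a + min (δ (E t)) (t - a) with ht₁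
  have h1 : t₁ ∈ Set.Ioc a t := by
    refine ⟨?_, ?_⟩
    · have : 0 < min (δ (E t)) (t - a) := lt_min hδ (by linarith)
      linarith
    · have := min_le_right (δ (E t)) (t - a)
      linarith
  have h2 : t₁ - a ≤ δ (E t) := by
    have := min_le_left (δ (E t)) (t - a)
    linarith
  have h3 : ∀ x ∈ Set.Ioc a t₁, N x ≤ Φ (N t₁) := fun x hx => by
    have hxt : x ∈ Set.Ioc a t := ⟨hx.1, hx.2.trans h1.2⟩
    obtain ⟨R, hR⟩ := hb x hxt
    refine H.bound t₁ x (E t) (N t₁) R (hE t₁ h1).le le_rfl ?_ fun y hy => ?_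
    · rw [abs_sub_comm, abs_of_nonneg (by linarith [hx.2])]
      linarith [hx.1]
    · rw [Set.uIcc_of_ge hx.2] at hy
      exact hR y ⟨hy.1, hy.2.trans h1.2⟩
  obtain ⟨R, hR⟩ := hb t₁ h1
  refine H.bound a t (m ^ 2) m (max m (max (Φ (N t₁)) R)) (H.le_of_le a m ha) ha ?_ fun x hx => ?_
  · rwa [abs_of_pos (by linarith)]
  · rw [Set.uIcc_of_le hat.le] at hx
    rcases hx.1.eq_or_lt with rfl | hax
    · exact ha.trans (le_max_left _ _)
    · refine le_max_of_le_right ?_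
      rcases le_total x t₁ with h | h
      · exact (h3 x ⟨hax, h⟩).trans (le_max_left _ _)
      · exact (hR x ⟨h, hx.2⟩).trans (le_max_right _ _)

theorem le_right (H : AprioriBound N E δ Φ) {t₀ t m : ℝ} (ht : t₀ ≤ t)
    (hm : ∀ x ∈ Set.Icc t₀ t, (∃ R, ∀ᶠ y in 𝓝 x, N y ≤ R) ∨ N x ≤ m) (h₀ : N t₀ ≤ m)
    (hd : t - t₀ ≤ δ (m ^ 2)) : N t ≤ max m (Φ m) := by
  set S := Set.Icc t₀ t ∩ {x | N x ≤ m} with hS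
  have hScpt : IsCompact S := isCompact_Icc.inter_right (H.isClosed_le m)
  obtain ⟨a, ⟨haI, hNa⟩, hmax⟩ :=
    hScpt.exists_isGreatest ⟨t₀, ⟨le_rfl, ht⟩, h₀⟩
  rcases haI.2.eq_or_lt with rfl | hat
  · exact (show N a ≤ m from hNa).trans (le_max_left _ _)
  · refine le_max_of_le_right (H.le_of_lt hat (fun x hx => ?_) hNa (by linarith [haI.1]))
    have hxI : x ∈ Set.Icc t₀ t := ⟨haI.1.trans hx.1.le, hx.2⟩
    refine (hm x hxI).resolve_right fun h => ?_
    exact absurd (hmax ⟨hxI, h⟩) (not_le.2 hx.1)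

theorem locally_bounded (H : AprioriBound N E δ Φ) (t : ℝ) : ∃ R, ∀ᶠ x in 𝓝 t, N x ≤ R := by
  set F := {t : ℝ | ¬ ∃ R, ∀ᶠ x in 𝓝 t, N x ≤ R} with hF
  have hFc : IsClosed F := by
    rw [← isOpen_compl_iff, isOpen_iff_mem_nhds]
    intro x hx
    obtain ⟨R, hR⟩ := not_not.1 hx
    filter_upwards [hR.eventually_nhds] with y hy
    exact not_not.2 ⟨R, hy⟩
  by_contra hcon
  have hne : Nonempty F := ⟨⟨t, hcon⟩⟩
  have : CompleteSpace F := hFc.completeSpace_coe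
  obtain ⟨k, ⟨t₀, ht₀⟩⟩ := nonempty_interior_of_iUnion_of_closed
    (f := fun k : ℕ => {x : F | N x ≤ k})
    (fun k => (H.isClosed_le k).preimage continuous_subtype_val)
    (Set.eq_univ_of_forall fun x => by
      obtain ⟨k, hk⟩ := exists_nat_ge (N x)
      exact Set.mem_iUnion.2 ⟨k, hk⟩)
  rw [mem_interior_iff_mem_nhds, Metric.mem_nhds_iff] at ht₀
  obtain ⟨ε, hε, hball⟩ := ht₀
  have hNk : ∀ x : ℝ, |x - t₀| < ε → (∃ R, ∀ᶠ y in 𝓝 x, N y ≤ R) ∨ N x ≤ k := fun x hx => by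
    by_cases h : ∃ R, ∀ᶠ y in 𝓝 x, N y ≤ R
    · exact Or.inl h
    · exact Or.inr (hball (a := ⟨x, h⟩) (by rwa [Metric.mem_ball, Subtype.dist_eq, Real.dist_eq]))
  have h₀ : N t₀ ≤ k := (hNk t₀ (by simpa using hε)).resolve_left t₀.2
  refine t₀.2 ⟨max k (Φ k), ?_⟩
  filter_upwards [Metric.ball_mem_nhds (t₀ : ℝ) (lt_min hε (H.pos ((k : ℝ) ^ 2)))] with x hx
  rw [Metric.mem_ball, Real.dist_eq, lt_min_iff] at hx
  obtain ⟨hx1, hx2⟩ := hx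
  rcases le_total (t₀ : ℝ) x with h | h
  · rw [abs_of_nonneg (by linarith)] at hx1 hx2
    refine H.le_right h (fun y hy => hNk y ?_) h₀ hx2.le
    rw [abs_of_nonneg (by linarith [hy.1])]
    linarith [hy.2]
  · rw [abs_of_nonpos (by linarith)] at hx1 hx2
    have := H.comp_neg.le_right (t₀ := -t₀) (t := -x) (m := k) (by linarith) (fun y hy => ?_)
      (by simpa using h₀) (by linarith)
    · simpa using this
    · refine (hNk (-y) ?_).imp (fun ⟨R, hR⟩ => ⟨R, ?_⟩) id
      · rw [abs_lt]
        constructor <;> linarith [hy.1, hy.2]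
      · exact (continuous_neg.tendsto y).eventually hR

end AprioriBound

theorem Hardy.norm_le_iff (Y : Hardy) {m : ℝ} (hm : 0 ≤ m) :
    ‖Y‖ ≤ m ↔ ∀ M, ∑ n ∈ Finset.range M, ‖Y n‖ ^ 2 ≤ m ^ 2 := by
  rw [← abs_of_nonneg (norm_nonneg Y), ← sq_le_sq₀ (abs_nonneg _) hm, sq_abs, Y.norm_sq_eq]
  exact ⟨fun h M => (Y.summable_norm_sq.sum_le_tsum _ fun n _ => by positivity).trans h,
    fun h => Real.tsum_le_of_sum_range_le (fun n => by positivity) h⟩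

section CoordinatewiseDerivative

variable {X G : ℝ → Hardy}

theorem isClosed_norm_le_of_coord (hX : ∀ n, Continuous fun t => X t n) (m : ℝ) :
    IsClosed {t | ‖X t‖ ≤ m} := by
  rcases lt_or_ge m 0 with hm | hm
  · have : {t | ‖X t‖ ≤ m} = ∅ :=
      Set.eq_empty_of_forall_notMem fun t ht => absurd (ht.trans_lt hm) (norm_nonneg _).not_gt
    rw [this]
    exact isClosed_empty
  · have : {t | ‖X t‖ ≤ m} = ⋂ M, {t | ∑ n ∈ Finset.range M, ‖X t n‖ ^ 2 ≤ m ^ 2} := by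
      ext t
      rw [Set.mem_iInter]
      exact (X t).norm_le_iff hm
    rw [this]
    exact isClosed_iInter fun M => isClosed_le
      (continuous_finsetSum _ fun n _ => ((hX n).norm.pow 2)) continuous_const

theorem norm_sub_le_of_coord (hX : ∀ n t, HasDerivAt (fun τ => X τ n) (G t n) t)
    {a b C : ℝ} (hG : ∀ t ∈ Set.uIcc a b, ‖G t‖ ≤ C) :
    ‖X b - X a‖ ≤ C * |b - a| := by
  have hC : 0 ≤ C := (norm_nonneg _).trans (hG a Set.left_mem_uIcc)
  refine (Hardy.norm_le_iff _ (by positivity)).2 fun M => ?_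
  set w : ℕ → ℂ := fun n => X b n - X a n
  set S := ∑ n ∈ Finset.range M, ‖w n‖ ^ 2
  have hS : 0 ≤ S := Finset.sum_nonneg fun n _ => by positivity
  change S ≤ _
  have hf : ∀ t ∈ Set.uIcc a b, HasDerivWithinAt
      (fun τ => ∑ n ∈ Finset.range M, conj (w n) * X τ n)
      (∑ n ∈ Finset.range M, conj (w n) * G t n) (Set.uIcc a b) t := fun t _ =>
    (HasDerivAt.fun_sum fun n _ => (hX n t).const_mul (conj (w n))).hasDerivWithinAt
  have hf' : ∀ t ∈ Set.uIcc a b, ‖∑ n ∈ Finset.range M, conj (w n) * G t n‖ ≤ √S * C :=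
    fun t ht => by
    calc ‖∑ n ∈ Finset.range M, conj (w n) * G t n‖
        ≤ ∑ n ∈ Finset.range M, ‖w n‖ * ‖G t n‖ := by
          refine (norm_sum_le _ _).trans_eq (Finset.sum_congr rfl fun n _ => ?_)
          rw [norm_mul, RCLike.norm_conj]
      _ ≤ √S * √(∑ n ∈ Finset.range M, ‖G t n‖ ^ 2) := Real.sum_mul_le_sqrt_mul_sqrt _ _ _
      _ ≤ √S * C := by
          refine mul_le_mul_of_nonneg_left ?_ (Real.sqrt_nonneg _)
          exact Real.sqrt_le_iff.2 ⟨hC, ((G t).norm_le_iff hC).1 (hG t ht) M⟩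
  have h1 := (convex_uIcc a b).norm_image_sub_le_of_norm_hasDerivWithin_le hf hf'
    Set.left_mem_uIcc Set.right_mem_uIcc
  have h2 : ∑ n ∈ Finset.range M, conj (w n) * X b n - ∑ n ∈ Finset.range M, conj (w n) * X a n
      = (S : ℂ) := by
    rw [← Finset.sum_sub_distrib, Complex.ofReal_sum]
    refine Finset.sum_congr rfl fun n _ => ?_
    rw [← mul_sub, Complex.ofReal_pow, ← Complex.conj_mul']
  rw [h2, Complex.norm_real, Real.norm_of_nonneg hS, Real.norm_eq_abs] at h1
  have h3 : √S * √S = S := Real.mul_self_sqrt hS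
  rcases hS.eq_or_lt with h0 | h0
  · rw [← h0]
    positivity
  · have h4 : √S ≤ C * |b - a| := by
      refine le_of_mul_le_mul_left ?_ (Real.sqrt_pos.2 h0)
      linarith
    rw [← h3, sq]
    exact mul_self_le_mul_self (Real.sqrt_nonneg _) h4

theorem norm_le_mul_exp_right (hX : ∀ n t, HasDerivAt (fun τ => X τ n) (G t n) t)
    {a b K C : ℝ} (hab : a ≤ b) (hK : 0 ≤ K)
    (hC : ∀ t ∈ Set.Icc a b, ‖X t‖ ≤ C) (hG : ∀ t ∈ Set.Icc a b, ‖G t‖ ≤ K * ‖X t‖) :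
    ‖X b‖ ≤ ‖X a‖ * Real.exp (K * (b - a)) := by
  have hC0 : 0 ≤ C := (norm_nonneg _).trans (hC a ⟨le_rfl, hab⟩)
  have hle : ∀ {x y c : ℝ}, x ≤ y → (∀ t ∈ Set.Icc x y, ‖G t‖ ≤ c) →
      ‖X y‖ - ‖X x‖ ≤ c * (y - x) ∧ ‖X x‖ - ‖X y‖ ≤ c * (y - x) := fun {x y c} hxy h => by
    have := norm_sub_le_of_coord hX (a := x) (b := y) (C := c) (by rwa [Set.uIcc_of_le hxy])
    rw [abs_of_nonneg (by linarith)] at this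
    exact ⟨(norm_sub_norm_le _ _).trans this,
      (norm_sub_norm_le _ _).trans ((norm_sub_rev _ _).trans_le this)⟩
  have hGC : ∀ t ∈ Set.Icc a b, ‖G t‖ ≤ K * C := fun t ht =>
    (hG t ht).trans (mul_le_mul_of_nonneg_left (hC t ht) hK)
  have hLip : LipschitzOnWith (K * C).toNNReal (fun t => ‖X t‖) (Set.Icc a b) := by
    refine LipschitzOnWith.of_le_add_mul _ fun x hx y hy => ?_
    rw [Real.coe_toNNReal _ (by positivity), Real.dist_eq]
    rcases le_total x y with h | h
    · have := (hle h fun t ht => hGC t ⟨hx.1.trans ht.1, ht.2.trans hy.2⟩).2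
      rw [abs_sub_comm, abs_of_nonneg (by linarith)]
      linarith
    · have := (hle h fun t ht => hGC t ⟨hy.1.trans ht.1, ht.2.trans hx.2⟩).1
      rw [abs_of_nonneg (by linarith)]
      linarith
  have hcont := hLip.continuousOn
  have h := le_gronwallBound_of_liminf_deriv_right_le (f := fun t => ‖X t‖)
    (f' := fun t => K * ‖X t‖) (δ := ‖X a‖) (K := K) (ε := 0) hcont (fun x hx c hc => ?_)
    le_rfl (fun x _ => (add_zero _).ge) b ⟨hab, le_rfl⟩
  · rwa [gronwallBound_ε0] at h
  · obtain ⟨c', hc1, hc2⟩ := exists_between hc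
    have h1 : ∀ᶠ y in 𝓝[Set.Icc a b] x, K * ‖X y‖ < c' :=
      ((hcont x ⟨hx.1, hx.2.le⟩).const_mul K).eventually_lt_const hc1
    obtain ⟨d, hd, hd'⟩ := Metric.mem_nhdsWithin_iff.1 h1
    have h2 : ∀ᶠ z in 𝓝[>] x, z ∈ Set.Ioo x (min (x + d) b) :=
      Ioo_mem_nhdsGT (lt_min (by linarith) hx.2)
    refine (h2.mono fun z hz => ?_).frequently
    have hz' := lt_min_iff.1 hz.2
    have h3 := (hle hz.1.le (c := c') fun t ht => ?_).1
    · rw [inv_mul_lt_iff₀ (by linarith [hz.1])]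
      refine h3.trans_lt ?_
      rw [mul_comm]
      exact mul_lt_mul_of_pos_left hc2 (by linarith [hz.1])
    · have htI : t ∈ Set.Icc a b := ⟨hx.1.trans ht.1, ht.2.trans hz'.2.le⟩
      refine (hG t htI).trans (le_of_lt (hd' ⟨?_, htI⟩))
      rw [Metric.mem_ball, Real.dist_eq, abs_of_nonneg (by linarith [ht.1])]
      linarith [ht.2, hz'.1]

theorem norm_le_mul_exp (hX : ∀ n t, HasDerivAt (fun τ => X τ n) (G t n) t)
    {a b K C : ℝ} (hK : 0 ≤ K)
    (hC : ∀ t ∈ Set.uIcc a b, ‖X t‖ ≤ C) (hG : ∀ t ∈ Set.uIcc a b, ‖G t‖ ≤ K * ‖X t‖) :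
    ‖X b‖ ≤ ‖X a‖ * Real.exp (K * |b - a|) := by
  rcases le_total a b with h | h
  · rw [Set.uIcc_of_le h] at hC hG
    rw [abs_of_nonneg (by linarith)]
    exact norm_le_mul_exp_right hX h hK hC hG
  · rw [Set.uIcc_of_ge h] at hC hG
    have hX' : ∀ n t, HasDerivAt (fun τ => X (-τ) n) ((-G (-t)) n) t := fun n t => by
      have := (hX n (-t)).scomp t (hasDerivAt_neg t)
      rw [neg_one_smul] at this
      exact this
    have hm : ∀ {t}, t ∈ Set.Icc (-a) (-b) → -t ∈ Set.Icc b a := fun ht =>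
      ⟨by linarith [ht.2], by linarith [ht.1]⟩
    have := norm_le_mul_exp_right (X := fun t => X (-t)) (G := fun t => -G (-t)) hX'
      (neg_le_neg h) hK (fun t ht => hC _ (hm ht)) fun t ht => by
        rw [norm_neg]
        exact hG _ (hm ht)
    simp only [neg_neg] at this
    rw [abs_of_nonpos (by linarith)]
    convert this using 3
    ring

end CoordinatewiseDerivative

/-- The `H^{1/2}` energy of the sequence with weighted coefficients `Y`. -/
def energy {r : ℝ} (hr : 1 / 2 < r) (Y : Hardy) : ℝ :=
  ∑' n : ℕ, (1 + n : ℝ) * ‖unweight hr Y n‖ ^ 2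

theorem energy_term_le {r : ℝ} (hr : 1 / 2 < r) (Y : Hardy) (n : ℕ) :
    (1 + n : ℝ) * ‖unweight hr Y n‖ ^ 2 ≤ ‖Y n‖ ^ 2 := by
  have h := one_add_mul_norm_mul_le hr Y n (norm_nonneg _) (weight_mul_norm_unweight hr Y n).le
  rwa [← sq, ← sq] at h

theorem summable_energy {r : ℝ} (hr : 1 / 2 < r) (Y : Hardy) :
    Summable fun n : ℕ => (1 + n : ℝ) * ‖unweight hr Y n‖ ^ 2 :=
  Summable.of_nonneg_of_le (fun n => by positivity) (energy_term_le hr Y) Y.summable_norm_sq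

theorem energy_nonneg {r : ℝ} (hr : 1 / 2 < r) (Y : Hardy) : 0 ≤ energy hr Y :=
  tsum_nonneg fun n => by positivity

theorem energy_le {r : ℝ} (hr : 1 / 2 < r) (Y : Hardy) : energy hr Y ≤ ‖Y‖ ^ 2 := by
  rw [Y.norm_sq_eq]
  exact (summable_energy hr Y).tsum_le_tsum (energy_term_le hr Y) Y.summable_norm_sq

theorem sq_sum_norm_le_log_mul_energy {r : ℝ} (hr : 1 / 2 < r) (Y : Hardy) (M : ℕ) :
    (∑ n ∈ Finset.range M, ‖unweight hr Y n‖) ^ 2 ≤ (1 + Real.log M) * energy hr Y := by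
  set u := unweight hr Y
  have h1 : ∀ n : ℕ, ‖u n‖ = √((1 + n : ℝ)⁻¹) * (√(1 + n : ℝ) * ‖u n‖) := fun n => by
    rw [← mul_assoc, ← Real.sqrt_mul (by positivity), inv_mul_cancel₀ (by positivity),
      Real.sqrt_one, one_mul]
  have h2 : ∑ n ∈ Finset.range M, (1 + n : ℝ)⁻¹ ≤ 1 + Real.log M := by
    have h := harmonic_le_one_add_log M
    rw [harmonic, Rat.cast_sum] at h
    refine (Finset.sum_congr rfl fun n _ => ?_).trans_le h
    push_cast
    rw [add_comm]
  calc (∑ n ∈ Finset.range M, ‖u n‖) ^ 2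
      = (∑ n ∈ Finset.range M, √((1 + n : ℝ)⁻¹) * (√(1 + n : ℝ) * ‖u n‖)) ^ 2 := by
        rw [← Finset.sum_congr rfl fun n _ => h1 n]
    _ ≤ (∑ n ∈ Finset.range M, √((1 + n : ℝ)⁻¹) ^ 2) *
          ∑ n ∈ Finset.range M, (√(1 + n : ℝ) * ‖u n‖) ^ 2 :=
        Finset.sum_mul_sq_le_sq_mul_sq _ _ _
    _ = (∑ n ∈ Finset.range M, (1 + n : ℝ)⁻¹) *
          ∑ n ∈ Finset.range M, (1 + n : ℝ) * ‖u n‖ ^ 2 := by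
        congr 1 <;> refine Finset.sum_congr rfl fun n _ => ?_
        · exact Real.sq_sqrt (by positivity)
        · rw [mul_pow, Real.sq_sqrt (by positivity)]
    _ ≤ (1 + Real.log M) * energy hr Y := by
        refine mul_le_mul h2 ((summable_energy hr Y).sum_le_tsum _ fun n _ => by positivity)
          (Finset.sum_nonneg fun n _ => by positivity) ?_
        exact (Finset.sum_nonneg fun n _ => by positivity).trans h2

/-- The growth rate in the logarithmic estimate for the vector field. -/
def growthRate (r α e : ℝ) : ℝ :=
  8 * (1 + (r - 1 / 2)⁻¹) * |e| + 4 * embeddingConst r + |α| + 1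

theorem growthRate_pos {r : ℝ} (hr : 1 / 2 < r) (α e : ℝ) : 0 < growthRate r α e := by
  have h1 := embeddingConst_nonneg r
  have h2 : 0 < (r - 1 / 2)⁻¹ := inv_pos.2 (by linarith)
  rw [growthRate]
  positivity

/-- A logarithmic (Brezis–Gallouët type) estimate. -/
theorem two_mul_norm_unweight_sq_le {r : ℝ} (hr : 1 / 2 < r) (α : ℝ) (Y : Hardy) {R e : ℝ}
    (hR : 1 ≤ R) (hY : ‖Y‖ ≤ R) (he : energy hr Y ≤ e) :
    2 * ‖unweight hr Y‖ ^ 2 + |α| ≤ growthRate r α e * (1 + Real.log R) := by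
  have hκ : 0 < r - 1 / 2 := by linarith
  set κ := r - 1 / 2 with hκd
  have hE := energy_nonneg hr Y
  have he0 : 0 ≤ e := hE.trans he
  have hS := embeddingConst_nonneg r
  set S := embeddingConst r
  have hlog : 0 ≤ Real.log R := Real.log_nonneg hR
  have hR0 : 0 < R := by linarith
  set P := R ^ (2 / κ)
  have hP : 1 ≤ P := Real.one_le_rpow hR (by positivity)
  set M := ⌈P⌉₊
  have hM1 : P ≤ M := Nat.le_ceil P
  have hM2 : (M : ℝ) ≤ 2 * P := (Nat.ceil_lt_add_one (by linarith)).le.trans (by linarith)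
  have hlogM : Real.log M ≤ 1 + 2 / κ * Real.log R := by
    calc Real.log M ≤ Real.log (2 * P) := Real.log_le_log (by linarith) hM2
      _ = Real.log 2 + 2 / κ * Real.log R := by
          rw [Real.log_mul (by norm_num) (by linarith), Real.log_rpow hR0]
      _ ≤ _ := by linarith [Real.log_two_lt_d9]
  have htail : tailConst r M ^ 2 * R ^ 2 ≤ S := by
    rw [tailConst_sq, mul_assoc]
    refine mul_le_of_le_one_right hS ?_
    have h1 : (1 + M : ℝ) ^ (-κ) ≤ P ^ (-κ) :=
      Real.rpow_le_rpow_of_nonpos (by linarith) (by linarith) (by linarith)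
    have h2 : P ^ (-κ) = (R ^ 2)⁻¹ := by
      rw [← Real.rpow_mul hR0.le, show 2 / κ * -κ = -(2 : ℕ) by field_simp; norm_num,
        Real.rpow_neg hR0.le, Real.rpow_natCast]
    calc (1 + M : ℝ) ^ (-κ) * R ^ 2 ≤ (R ^ 2)⁻¹ * R ^ 2 :=
          mul_le_mul_of_nonneg_right (h1.trans_eq h2) (by positivity)
      _ = 1 := inv_mul_cancel₀ (by positivity)
  have hA := sq_sum_norm_le_log_mul_energy hr Y M
  set A := ∑ n ∈ Finset.range M, ‖unweight hr Y n‖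
  have hu : ‖unweight hr Y‖ ≤ A + tailConst r M * R :=
    (norm_unweight_le hr Y M).trans (by gcongr; exact tailConst_nonneg r M)
  have hA2 : A ^ 2 ≤ (2 + 2 / κ * Real.log R) * e := hA.trans
    (mul_le_mul (by linarith) he hE (by positivity))
  have hu2 : ‖unweight hr Y‖ ^ 2 ≤ 2 * A ^ 2 + 2 * (tailConst r M ^ 2 * R ^ 2) := by
    calc ‖unweight hr Y‖ ^ 2 ≤ (A + tailConst r M * R) ^ 2 := by gcongr
      _ ≤ _ := by nlinarith [sq_nonneg (A - tailConst r M * R)]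
  rw [growthRate, abs_of_nonneg he0, ← hκd]
  have hα := abs_nonneg α
  have hκe : 0 ≤ κ⁻¹ * e := by positivity
  have h3 : 2 / κ * Real.log R * e = 2 * (Real.log R * (κ⁻¹ * e)) := by
    rw [div_eq_mul_inv]
    ring
  have h4 : 0 ≤ Real.log R * (κ⁻¹ * e) := by positivity
  have h5 : 0 ≤ Real.log R * e := by positivity
  have h6 : 0 ≤ Real.log R * S := by positivity
  have h7 : 0 ≤ Real.log R * |α| := by positivity
  nlinarith

section Trajectory

variable {r : ℝ} {hr : 1 / 2 < r} {hr1 : r ≤ 1} {α : ℝ} {X : ℝ → Hardy}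

theorem norm_unweight_le_mul (hr : 1 / 2 < r) (Y : Hardy) :
    ‖unweight hr Y‖ ≤ tailConst r 0 * ‖Y‖ := by
  simpa using norm_unweight_le hr Y 0

theorem hasDerivAt_unweight
    (hX : ∀ n t, HasDerivAt (fun τ => X τ n) (weightedField hr hr1 α (X t) n) t) (n : ℕ) (t : ℝ) :
    HasDerivAt (fun τ => unweight hr (X τ) n)
      (-I * (cubic (unweight hr (X t)) n + (α : ℂ) * unweight hr (X t) 0 * oneSeq n)) t := by
  have h := (hX n t).const_mul ((((weight r n)⁻¹ : ℝ)) : ℂ)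
  rw [weightedField_apply, ← mul_assoc, ← ofReal_mul, inv_mul_cancel₀ (weight_pos r n).ne',
    ofReal_one, one_mul] at h
  exact h

theorem inner_szego_field (α : ℝ) (x c y d : ℂ) (hd : d = 0 ∨ d = 1 ∧ y = x) :
    inner ℝ x (-I * (c + (α : ℂ) * y * d)) = (conj x * c).im := by
  rw [Complex.inner]
  rcases hd with rfl | ⟨rfl, rfl⟩
  · simp
    ring
  · simp
    ring

theorem hasDerivAt_truncated_energy
    (hX : ∀ n t, HasDerivAt (fun τ => X τ n) (weightedField hr hr1 α (X t) n) t) (M : ℕ) (t : ℝ) :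
    HasDerivAt (fun τ => ∑ n ∈ Finset.range M, (1 + n : ℝ) * ‖unweight hr (X τ) n‖ ^ 2)
      (2 * ∑ n ∈ Finset.range M,
        (1 + n : ℝ) * (conj (unweight hr (X t) n) * cubic (unweight hr (X t)) n).im) t := by
  rw [Finset.mul_sum]
  refine HasDerivAt.fun_sum fun n _ => ?_
  have h1 := ((hasDerivAt_unweight hX n t).norm_sq).const_mul (1 + n : ℝ)
  refine h1.congr_deriv ?_
  have h2 := inner_szego_field α (unweight hr (X t) n) (cubic (unweight hr (X t)) n)
    (unweight hr (X t) 0) (oneSeq n) <| by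
      by_cases hn : n = 0
      · subst hn
        exact Or.inr ⟨if_pos rfl, rfl⟩
      · exact Or.inl (if_neg hn)
  exact (congrArg (fun x => (1 + n : ℝ) * (2 * x)) h2).trans (by ring)

theorem energy_eq_of_bounded
    (hX : ∀ n t, HasDerivAt (fun τ => X τ n) (weightedField hr hr1 α (X t) n) t) {a b R : ℝ}
    (hR : ∀ t ∈ Set.uIcc a b, ‖X t‖ ≤ R) : energy hr (X a) = energy hr (X b) := by
  have hR0 : 0 ≤ R := (norm_nonneg _).trans (hR a Set.left_mem_uIcc)
  have hT := tailConst_nonneg r 0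
  set C := 2 * (2 * (tailConst r 0 * R) ^ 2 * R ^ 2) * |b - a| with hC
  have hbound : ∀ M : ℕ,
      |∑ n ∈ Finset.range M, (1 + n : ℝ) * ‖unweight hr (X b) n‖ ^ 2 -
        ∑ n ∈ Finset.range M, (1 + n : ℝ) * ‖unweight hr (X a) n‖ ^ 2|
      ≤ (1 + M : ℝ) ^ (-(2 * r - 1)) * C := fun M => by
    have h := (convex_uIcc a b).norm_image_sub_le_of_norm_hasDerivWithin_le
      (C := (1 + M : ℝ) ^ (-(2 * r - 1)) * (2 * (2 * (tailConst r 0 * R) ^ 2 * R ^ 2)))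
      (fun t _ => (hasDerivAt_truncated_energy hX M t).hasDerivWithinAt) (fun t ht => ?_)
      Set.left_mem_uIcc Set.right_mem_uIcc
    · rwa [Real.norm_eq_abs, Real.norm_eq_abs, mul_assoc, ← hC] at h
    · rw [norm_mul, Real.norm_eq_abs, Real.norm_eq_abs, abs_two]
      have h1 := abs_truncated_flux_le hr hr1 (X t) M
      have h2 : ‖unweight hr (X t)‖ ≤ tailConst r 0 * R :=
        (norm_unweight_le_mul hr _).trans (mul_le_mul_of_nonneg_left (hR t ht) hT)
      have h3 : (1 + M : ℝ) ^ (-(2 * r - 1)) * (2 * ‖unweight hr (X t)‖ ^ 2 * ‖X t‖ ^ 2)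
          ≤ (1 + M : ℝ) ^ (-(2 * r - 1)) * (2 * (tailConst r 0 * R) ^ 2 * R ^ 2) := by
        have := hR t ht
        gcongr
      linarith
  have h1 : Tendsto (fun M : ℕ => (1 + M : ℝ) ^ (-(2 * r - 1)) * C) atTop (𝓝 (0 * C)) := by
    refine Tendsto.mul_const C ?_
    exact (tendsto_rpow_neg_atTop (by linarith)).comp
      (tendsto_atTop_add_const_left _ _ tendsto_natCast_atTop_atTop)
  rw [zero_mul] at h1
  have h2 := (((summable_energy hr (X b)).hasSum.tendsto_sum_nat).sub
    ((summable_energy hr (X a)).hasSum.tendsto_sum_nat)).abs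
  have h3 := le_of_tendsto_of_tendsto' h2 h1 hbound
  exact (sub_eq_zero.1 (abs_nonpos_iff.1 h3)).symm

theorem norm_le_of_short_time
    (hX : ∀ n t, HasDerivAt (fun τ => X τ n) (weightedField hr hr1 α (X t) n) t)
    {a b e m R : ℝ} (he : energy hr (X a) ≤ e) (hm : ‖X a‖ ≤ m)
    (hd : |b - a| ≤ (2 * growthRate r α e)⁻¹) (hR : ∀ t ∈ Set.uIcc a b, ‖X t‖ ≤ R) :
    ‖X b‖ ≤ max 1 (3 * m ^ 2) := by
  have hB := growthRate_pos hr α e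
  set B := growthRate r α e
  have hbdd : BddAbove ((fun t => ‖X t‖) '' Set.uIcc a b) :=
    ⟨R, by rintro _ ⟨t, ht, rfl⟩; exact hR t ht⟩
  set s := sSup ((fun t => ‖X t‖) '' Set.uIcc a b)
  have hs : ∀ t ∈ Set.uIcc a b, ‖X t‖ ≤ s := fun t ht => le_csSup hbdd ⟨t, ht, rfl⟩
  refine (hs b Set.right_mem_uIcc).trans ?_
  rcases le_total s 1 with h1 | h1
  · exact h1.trans (le_max_left _ _)
  refine le_max_of_le_right ?_
  set K := B * (1 + Real.log s) with hK
  have hlog := Real.log_nonneg h1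
  have hK0 : 0 ≤ K := by positivity
  have hm0 : 0 ≤ m := (norm_nonneg _).trans hm
  have hsub : ∀ t ∈ Set.uIcc a b, Set.uIcc a t ⊆ Set.uIcc a b := fun t ht =>
    Set.uIcc_subset_uIcc_left ht
  have hG : ∀ t ∈ Set.uIcc a b, ‖weightedField hr hr1 α (X t)‖ ≤ K * ‖X t‖ := fun t ht => by
    refine (norm_weightedField_le hr hr1 α _).trans
      (mul_le_mul_of_nonneg_right ?_ (norm_nonneg _))
    refine two_mul_norm_unweight_sq_le hr α _ h1 (hs t ht) ?_
    rwa [← energy_eq_of_bounded hX fun x hx => hs x (hsub t ht hx)]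
  have h2 : ∀ t ∈ Set.uIcc a b, ‖X t‖ ≤ m * Real.exp ((1 + Real.log s) / 2) := fun t ht => by
    refine (norm_le_mul_exp hX hK0 (fun x hx => hs x (hsub t ht hx))
      fun x hx => hG x (hsub t ht hx)).trans ?_
    refine mul_le_mul hm (Real.exp_le_exp.2 ?_) (Real.exp_pos _).le hm0
    have h3 : |t - a| ≤ (2 * B)⁻¹ := (Set.abs_sub_left_of_mem_uIcc ht).trans hd
    calc K * |t - a| ≤ K * (2 * B)⁻¹ := mul_le_mul_of_nonneg_left h3 hK0
      _ = (1 + Real.log s) / 2 := by rw [hK]; field_simp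
  have h4 : s ≤ m * Real.exp ((1 + Real.log s) / 2) := by
    refine csSup_le (Set.nonempty_uIcc.image _) ?_
    rintro _ ⟨t, ht, rfl⟩
    exact h2 t ht
  have h5 : s * s ≤ 3 * m ^ 2 * s := by
    calc s * s ≤ (m * Real.exp ((1 + Real.log s) / 2)) * (m * Real.exp ((1 + Real.log s) / 2)) :=
          mul_self_le_mul_self (by linarith) h4
      _ = m ^ 2 * (Real.exp 1 * s) := by
          rw [mul_mul_mul_comm, ← Real.exp_add, add_halves, Real.exp_add,
            Real.exp_log (by linarith), sq]
      _ ≤ m ^ 2 * (3 * s) := by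
          have := Real.exp_one_lt_d9
          gcongr
          linarith
      _ = _ := by ring
  exact le_of_mul_le_mul_right h5 (by linarith)

theorem aprioriBound_norm
    (hX : ∀ n t, HasDerivAt (fun τ => X τ n) (weightedField hr hr1 α (X t) n) t) :
    AprioriBound (fun t => ‖X t‖) (fun t => energy hr (X t))
      (fun e => (2 * growthRate r α e)⁻¹) (fun m => max 1 (3 * m ^ 2)) where
  isClosed_le := isClosed_norm_le_of_coord fun n =>
    continuous_iff_continuousAt.2 fun t => (hX n t).continuousAt
  pos e := by
    have := growthRate_pos hr α e
    positivity
  conserved _ _ _ h := energy_eq_of_bounded hX h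
  le_of_le _ _ h := (energy_le hr _).trans (by gcongr)
  bound _ _ _ _ _ he hm hd hR := norm_le_of_short_time hX he hm hd hR

theorem hasDerivAt_unweight_wiener
    (hX : ∀ n t, HasDerivAt (fun τ => X τ n) (weightedField hr hr1 α (X t) n) t)
    (hG : ∀ n, Continuous fun t => weightedField hr hr1 α (X t) n) (t : ℝ) :
    HasDerivAt (fun τ => unweight hr (X τ)) (unweight hr (weightedField hr hr1 α (X t))) t := by
  have hV : Continuous fun t => unweight hr (weightedField hr hr1 α (X t)) := by
    refine continuous_unweight_comp hr hG fun t₀ => ?_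
    obtain ⟨R, hR⟩ := (aprioriBound_norm hX).locally_bounded t₀
    refine ⟨(2 * (tailConst r 0 * R) ^ 2 + |α|) * R, hR.mono fun x hx => ?_⟩
    have hT := tailConst_nonneg r 0
    have h1 : ‖unweight hr (X x)‖ ≤ tailConst r 0 * R :=
      (norm_unweight_le_mul hr _).trans (mul_le_mul_of_nonneg_left hx hT)
    refine (norm_weightedField_le hr hr1 α _).trans ?_
    gcongr
  set V := fun t => unweight hr (weightedField hr hr1 α (X t)) with hVd
  have hZ : ∀ t, HasDerivAt (fun τ => unweight hr (X 0) + ∫ x in (0 : ℝ)..τ, V x) (V t) t :=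
    fun t => (intervalIntegral.integral_hasDerivAt_right (hV.intervalIntegrable _ _)
      (hV.stronglyMeasurableAtFilter _ _) hV.continuousAt).const_add _
  have hcoord : ∀ n τ, (unweight hr (X 0) + ∫ x in (0 : ℝ)..τ, V x) n = unweight hr (X τ) n :=
    fun n τ => by
    have h1 : ∀ t, HasDerivAt (fun τ => (unweight hr (X 0) + ∫ x in (0 : ℝ)..τ, V x) n
        - unweight hr (X τ) n) 0 t := fun t => by
      have h2 : HasDerivAt (fun τ => unweight hr (X τ) n) (V t n) t :=
        (hX n t).const_mul ((((weight r n)⁻¹ : ℝ)) : ℂ)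
      have h3 : HasDerivAt (fun τ => (unweight hr (X 0) + ∫ x in (0 : ℝ)..τ, V x) n) (V t n) t :=
        (lp.evalCLM (𝕜 := ℝ) (E := fun _ : ℕ => ℂ) 1 n).hasFDerivAt.comp_hasDerivAt t (hZ t)
      have h4 := h3.sub h2
      rwa [sub_self] at h4
    have h5 := is_const_of_deriv_eq_zero (fun t => (h1 t).differentiableAt)
      (fun t => (h1 t).deriv) τ 0
    simp only [intervalIntegral.integral_same, add_zero, sub_self] at h5
    exact sub_eq_zero.1 h5
  have hU : (fun τ => unweight hr (X τ))
      = fun τ => unweight hr (X 0) + ∫ x in (0 : ℝ)..τ, V x :=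
    funext fun τ => Subtype.ext (funext fun n => (hcoord n τ).symm)
  rw [hU]
  exact hZ t

end Trajectory

theorem MemHs.summable_weighted {s r : ℝ} (hr : 1 / 2 < r) (hrs : r ≤ s) {u : ℕ → ℂ}
    (hu : MemHs s u) : Summable fun n => ‖(weight r n : ℂ) * u n‖ ^ 2 := by
  have hu' : Summable fun n : ℕ => (2 : ℝ) ^ r * (((1 : ℝ) + (n : ℝ) ^ 2) ^ s * ‖u n‖ ^ 2) :=
    hu.mul_left _
  refine hu'.of_nonneg_of_le (fun n => by positivity) fun n => ?_
  rw [norm_mul, mul_pow, Complex.norm_real, Real.norm_of_nonneg (weight_pos r n).le, ← mul_assoc]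
  refine mul_le_mul_of_nonneg_right ?_ (by positivity)
  calc weight r n ^ 2 = ((1 + n : ℝ) ^ 2) ^ r := by
        rw [weight, ← Real.rpow_natCast, ← Real.rpow_natCast, ← Real.rpow_mul (by positivity),
          ← Real.rpow_mul (by positivity), mul_comm]
    _ ≤ (2 * (1 + (n : ℝ) ^ 2)) ^ r := by
        refine Real.rpow_le_rpow (by positivity) ?_ (by linarith)
        nlinarith [sq_nonneg ((n : ℝ) - 1)]
    _ = 2 ^ r * (1 + (n : ℝ) ^ 2) ^ r := Real.mul_rpow (by norm_num) (by positivity)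
    _ ≤ 2 ^ r * (1 + (n : ℝ) ^ 2) ^ s := by
        gcongr
        exact le_add_of_nonneg_right (sq_nonneg _)

/-- Solutions of the α-Szegő equation are differentiable in the Wiener algebra. -/
theorem exists_wiener_solution {α s : ℝ} (hs : 1 / 2 < s) {u : ℝ → ℕ → ℂ}
    (hreg : SmoothHsCurve s u) (hsol : SolvesSzego α u) :
    ∃ U V : ℝ → Wiener, (∀ t, u t = U t) ∧ (∀ t, HasDerivAt U (V t) t) ∧
      ∀ t n, V t n = -I * (cubic (U t) n + (α : ℂ) * U t 0 * oneSeq n) := by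
  obtain ⟨r, hr, hr1, hrs⟩ : ∃ r : ℝ, 1 / 2 < r ∧ r ≤ 1 ∧ r ≤ s :=
    ⟨min s 1, lt_min hs (by norm_num), min_le_right _ _, min_le_left _ _⟩
  let X : ℝ → Hardy := fun t => ⟨fun n => (weight r n : ℂ) * u t n,
    memℓp_two_iff.2 ((hreg.1 t).summable_weighted hr hrs)⟩
  have hU : ∀ t, (unweight hr (X t) : ℕ → ℂ) = u t := fun t => funext fun n => by
    refine (unweight_apply hr (X t) n).trans ?_
    change _ * ((weight r n : ℂ) * u t n) = _
    rw [← mul_assoc, ← ofReal_mul, inv_mul_cancel₀ (weight_pos r n).ne', ofReal_one, one_mul]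
  have hG : ∀ t n, weightedField hr hr1 α (X t) n
      = (weight r n : ℂ) * (-I * (cubic (u t) n + (α : ℂ) * u t 0 * oneSeq n)) := fun t n => by
    rw [← hU t]
    exact weightedField_apply hr hr1 α (X t) n
  have hX : ∀ n t, HasDerivAt (fun τ => X τ n) (weightedField hr hr1 α (X t) n) t := fun n t =>
    ((hsol n t).const_mul (weight r n : ℂ)).congr_deriv (hG t n).symm
  have hGc : ∀ n, Continuous fun t => weightedField hr hr1 α (X t) n := fun n => by
    have h1 : Continuous (deriv fun t => u t n) := (hreg.2 n).continuous_deriv (by simp)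
    refine (h1.const_mul (weight r n : ℂ)).congr fun t => ?_
    rw [(hsol n t).deriv]
    exact (hG t n).symm
  refine ⟨fun t => unweight hr (X t), fun t => unweight hr (weightedField hr hr1 α (X t)),
    fun t => (hU t).symm, hasDerivAt_unweight_wiener hX hGc, fun t n => ?_⟩
  refine (unweight_apply hr _ n).trans ?_
  rw [weightedField_apply, ← mul_assoc, ← ofReal_mul, inv_mul_cancel₀ (weight_pos r n).ne',
    ofReal_one, one_mul]

/-- Along any solution of the α-Szegő equation, `(K_u, C_u)` is a Lax
pair: `d/dt K_{u(t)} = [C_{u(t)}, K_{u(t)}]`; consequently `K_{u(t)}` is unitarily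
equivalent to `K_{u(0)}` and the spectrum of `K_{u(t)}²` is independent of `t`. -/
theorem alphaSzego_lax_pair_K (α s : ℝ) (hs : 1/2 < s) (u : ℝ → ℕ → ℂ)
    (hreg : SmoothHsCurve s u) (hsol : SolvesSzego α u) :
    (∀ h : ℕ → ℂ, MemL2 h → ∀ t k, HasDerivAt (fun τ => khankel (u τ) h k)
        (Cop (u t) (khankel (u t) h) k - khankel (u t) (Cop (u t) h) k) t) ∧
    (∀ t, ∃ U : Hardy ≃ₗᵢ[ℂ] Hardy,
      ∀ (h : Hardy) (hm : Memℓp (khankel (u 0) ⇑h) 2) (k : ℕ),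
        khankel (u t) (⇑(U h)) k = (U ⟨khankel (u 0) ⇑h, hm⟩) k) ∧
    (∀ t, {lam : ℂ | ∃ h : ℕ → ℂ, MemL2 h ∧ h ≠ 0 ∧ ku2 (u t) h = lam • h} =
          {lam : ℂ | ∃ h : ℕ → ℂ, MemL2 h ∧ h ≠ 0 ∧ ku2 (u 0) h = lam • h}) := by
  obtain ⟨U, V, hu, hU, hV⟩ := exists_wiener_solution hs hreg hsol
  exact lax_pair_of_hasDerivAt hu hU hV

end
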